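/- Fix integers m,n ≥ 1, a real number 1 ≤ p < n+1, and γ ≥ 1. There is a constant C > 0 depending only on m, n, p and γ with the following property: for every compact set Z ⊂ ℝ^m, every bounded domain (open connected set) Ω ⊂ ℝ^m with Z ⊂ Ω, every metric space Y that is Lipschitz (n−1)-connected with constant γ, every L ≥ 0 and every L-Lipschitz map f : Z → Y, there exists a map F : Ω → Y with F(x) = f(x) for all x ∈ Z which belongs to the class AR^{1,p}(Ω,Y); moreover, the function g in the definition of AR^{1,p}(Ω,Y) can be chosen with ‖g‖_{L^p(Ω)} ≤ C·L·(diam Ω)^{m/p}, and F can be chosen so that for every Lipschitz φ : Y → ℝ the function φ∘F is absolutely continuous on compact subintervals of ℓ = ℓ̄ ∩ Ω for (m−1)-almost every line ℓ̄ parallel to a coordinate axis, with classical partial derivatives in L^p(Ω). -/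

import Mathlib

open MeasureTheory Metric Set
noncomputable section

/-- `Euc d` is `ℝ^d` with the Euclidean metric. -/
abbrev Euc (d : ℕ) := EuclideanSpace ℝ (Fin d)

/-- A metric space `Y` is Lipschitz `(n−1)`-connected with constant `c ≥ 1`:
for `k = 0, 1, …, n−1`, every `L`-Lipschitz map from the unit sphere `S^k ⊂ ℝ^{k+1}`
into `Y` extends to a `cL`-Lipschitz map on the closed unit ball `B^{k+1}`. -/
def LipschitzConnected (n : ℕ) (c : ℝ) (Y : Type) [MetricSpace Y] : Prop :=
  ∀ k : ℕ, k < n → ∀ L : ℝ, 0 ≤ L →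
    ∀ f : Euc (k+1) → Y,
      (∀ x ∈ Metric.sphere (0 : Euc (k+1)) 1, ∀ y ∈ Metric.sphere (0 : Euc (k+1)) 1,
        dist (f x) (f y) ≤ L * dist x y) →
      ∃ F : Euc (k+1) → Y,
        (∀ x ∈ Metric.closedBall (0 : Euc (k+1)) 1,
          ∀ y ∈ Metric.closedBall (0 : Euc (k+1)) 1,
            dist (F x) (F y) ≤ c * L * dist x y) ∧
        ∀ x ∈ Metric.sphere (0 : Euc (k+1)) 1, F x = f x

/-- `v` represents the distributional partial derivative `∂u/∂x_k` on `Ω`. -/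
def IsWeakPartialDeriv (m : ℕ) (Ω : Set (Euc m)) (u : Euc m → ℝ) (k : Fin m)
    (v : Euc m → ℝ) : Prop :=
  ∀ φ : Euc m → ℝ, ContDiff ℝ (⊤ : ℕ∞) φ → HasCompactSupport φ → tsupport φ ⊆ Ω →
    ∫ x in Ω, u x * fderiv ℝ φ x (EuclideanSpace.single k 1) = - ∫ x in Ω, v x * φ x

/-- `u ∈ L^p(Ω)`. -/
def MemLpOn (m : ℕ) (p : ℝ) (Ω : Set (Euc m)) (u : Euc m → ℝ) : Prop :=
  MemLp u (ENNReal.ofReal p) (volume.restrict Ω)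

/-- `u ∈ W^{1,p}(Ω)` with weak partial derivatives `v k = ∂u/∂x_k ∈ L^p(Ω)`. -/
def MemW1pWith (m : ℕ) (p : ℝ) (Ω : Set (Euc m)) (u : Euc m → ℝ)
    (v : Fin m → Euc m → ℝ) : Prop :=
  MemLpOn m p Ω u ∧ ∀ k, MemLpOn m p Ω (v k) ∧ IsWeakPartialDeriv m Ω u k (v k)

/-- `u : ℝ → ℝ` is absolutely continuous on `[a,b]`: it is the indefinite integral of
an integrable function. -/
def ACOn (u : ℝ → ℝ) (a b : ℝ) : Prop :=
  ∃ h : ℝ → ℝ, IntervalIntegrable h volume a b ∧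
    ∀ x ∈ Set.Icc a b, u x = u a + ∫ s in a..x, h s

section Proofs

open Filter Topology

/-- A pair `(F, G)` on a metric space `E` such that, off the closed set `Z`, the gap function `G` is
locally Lipschitz at each point, `F` has pointwise Lipschitz constant at most `M / G` where
`G > 0`, and `F` approaches its values on `Z` at a linear rate `M`. -/
structure GapControlled {E Y : Type*} [PseudoMetricSpace E] [PseudoMetricSpace Y]
    (Z : Set E) (F : E → Y) (G : E → ℝ) (M : ℝ) : Prop where
  isClosed : IsClosed Z
  const_nonneg : 0 ≤ M
  nonneg : ∀ x, 0 ≤ G x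
  eq_one : ∀ x ∈ Z, G x = 1
  gap_lip : ∀ x ∉ Z, ∃ B : ℝ, ∀ᶠ y in 𝓝 x, |G y - G x| ≤ B * dist y x
  map_lip : ∀ x ∉ Z, 0 < G x → ∀ᶠ y in 𝓝 x, dist (F y) (F x) ≤ M / G x * dist y x
  map_lip_core : ∀ x, 0 < G x → ∀ z ∈ Z, dist (F x) (F z) ≤ M * dist x z

/-- The upper gradient `M (1 + 1 / G)` attached to a gap function. -/
def gapGradient {E : Type*} (G : E → ℝ) (M : ℝ) (x : E) : ℝ := M * (1 + (G x)⁻¹)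

namespace GapControlled

variable {E Y : Type*} [PseudoMetricSpace E] [PseudoMetricSpace Y]
  {Z : Set E} {F : E → Y} {G : E → ℝ} {M : ℝ}

lemma comp_isometry (h : GapControlled Z F G M) {E' : Type*} [PseudoMetricSpace E'] {γ : E' → E}
    (hγ : Isometry γ) : GapControlled (γ ⁻¹' Z) (F ∘ γ) (G ∘ γ) M where
  isClosed := h.isClosed.preimage hγ.continuous
  const_nonneg := h.const_nonneg
  nonneg x := h.nonneg _
  eq_one x hx := h.eq_one _ hx
  gap_lip x hx := by
    obtain ⟨B, hB⟩ := h.gap_lip (γ x) hx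
    refine ⟨B, ?_⟩
    filter_upwards [hγ.continuous.continuousAt.eventually hB] with y hy
    simpa [hγ.dist_eq] using hy
  map_lip x hx h0 := by
    filter_upwards [hγ.continuous.continuousAt.eventually (h.map_lip (γ x) hx h0)] with y hy
    simpa [hγ.dist_eq] using hy
  map_lip_core x h0 z hz := by
    simpa [hγ.dist_eq] using h.map_lip_core (γ x) h0 (γ z) hz

lemma gapGradient_nonneg (h : GapControlled Z F G M) (x : E) : 0 ≤ gapGradient G M x :=
  mul_nonneg h.const_nonneg (add_nonneg zero_le_one (inv_nonneg.2 (h.nonneg x)))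

lemma le_gapGradient (h : GapControlled Z F G M) (x : E) : M ≤ gapGradient G M x :=
  le_mul_of_one_le_right h.const_nonneg (le_add_of_nonneg_right (inv_nonneg.2 (h.nonneg x)))

lemma div_le_gapGradient (h : GapControlled Z F G M) (x : E) : M / G x ≤ gapGradient G M x := by
  rw [div_eq_mul_inv]
  exact mul_le_mul_of_nonneg_left (by linarith) h.const_nonneg

lemma continuousAt_of_eventually_dist_le {X : Type*} [PseudoMetricSpace X] {f : E → X} {x : E}
    {B : ℝ} (hf : ∀ᶠ y in 𝓝 x, dist (f y) (f x) ≤ B * dist y x) : ContinuousAt f x := by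
  rw [ContinuousAt, tendsto_iff_dist_tendsto_zero]
  have h0 : Tendsto (fun y => B * dist y x) (𝓝 x) (𝓝 0) := by
    have : Tendsto (fun y => B * dist y x) (𝓝 x) (𝓝 (B * dist x x)) :=
      (continuous_const.mul (continuous_id.dist continuous_const)).tendsto x
    simpa using this
  exact tendsto_of_tendsto_of_tendsto_of_le_of_le' tendsto_const_nhds h0
    (Eventually.of_forall fun _ => dist_nonneg) hf

lemma continuousAt_gap (h : GapControlled Z F G M) {x : E} (hx : x ∉ Z) : ContinuousAt G x := by
  obtain ⟨B, hB⟩ := h.gap_lip x hx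
  exact continuousAt_of_eventually_dist_le (B := B) hB

lemma measurable_gap [MeasurableSpace E] [BorelSpace E] (h : GapControlled Z F G M) :
    Measurable G := by
  classical
  have h1 : ContinuousOn G Zᶜ := fun x hx => (h.continuousAt_gap hx).continuousWithinAt
  have h2 : G = Z.piecewise (fun _ => 1) G := by
    ext x
    by_cases hx : x ∈ Z
    · simp [hx, h.eq_one x hx]
    · simp [hx]
  rw [h2]
  exact ContinuousOn.measurable_piecewise continuousOn_const h1 h.isClosed.measurableSet

lemma dist_le_of_mem (h : GapControlled Z F G M) {x y : E} (hy : 0 < G y)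
    (hx : x ∈ Z) : dist (F y) (F x) ≤ gapGradient G M x * dist y x :=
  (h.map_lip_core y hy x hx).trans
    (mul_le_mul_of_nonneg_right (h.le_gapGradient x) dist_nonneg)

/-- Pointwise Lipschitz control inside the region where the gap is positive. -/
lemma eventually_dist_le (h : GapControlled Z F G M) {s : Set E} (hs : ∀ x ∈ s, 0 < G x)
    {x : E} (hx : x ∈ s) :
    ∀ᶠ y in 𝓝[s] x, dist (F y) (F x) ≤ gapGradient G M x * dist y x := by
  by_cases hZ : x ∈ Z
  · filter_upwards [self_mem_nhdsWithin] with y hy using h.dist_le_of_mem (hs y hy) hZ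
  · filter_upwards [nhdsWithin_le_nhds (h.map_lip x hZ (hs x hx))] with y hy
    exact hy.trans (mul_le_mul_of_nonneg_right (h.div_le_gapGradient x) dist_nonneg)

lemma continuousOn_map (h : GapControlled Z F G M) {s : Set E} (hs : ∀ x ∈ s, 0 < G x) :
    ContinuousOn F s := by
  intro x hx
  rw [ContinuousWithinAt, tendsto_iff_dist_tendsto_zero]
  have h0 : Tendsto (fun y => gapGradient G M x * dist y x) (𝓝[s] x) (𝓝 0) := by
    have : Tendsto (fun y => gapGradient G M x * dist y x) (𝓝 x)
        (𝓝 (gapGradient G M x * dist x x)) :=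
      (continuous_const.mul (continuous_id.dist continuous_const)).tendsto x
    simpa using this.mono_left nhdsWithin_le_nhds
  exact tendsto_of_tendsto_of_tendsto_of_le_of_le' tendsto_const_nhds h0
    (Eventually.of_forall fun _ => dist_nonneg) (h.eventually_dist_le hs hx)

end GapControlled

lemma enorm_inv_le_ofReal_inv {r : ℝ} (hr : 0 ≤ r) : ‖r⁻¹‖ₑ ≤ (ENNReal.ofReal r)⁻¹ := by
  rcases hr.eq_or_lt with rfl | hr
  · simp
  · rw [← ENNReal.ofReal_inv_of_pos hr, Real.enorm_eq_ofReal (inv_nonneg.2 hr.le)]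

namespace GapControlled

variable {Y : Type*} [PseudoMetricSpace Y] {Z : Set ℝ} {F : ℝ → Y} {G : ℝ → ℝ} {M : ℝ}

/-- If `1 / G` is integrable on an interval, then the gap `G` does not vanish there. -/
lemma pos_of_lintegral_ne_top (h : GapControlled Z F G M) {a b : ℝ} (hab : a < b)
    (hfin : ∫⁻ t in Icc a b, (ENNReal.ofReal (G t))⁻¹ ≠ ⊤) : ∀ t ∈ Icc a b, 0 < G t := by
  intro t ht
  by_contra hcon
  have hGt : G t = 0 := le_antisymm (not_lt.1 hcon) (h.nonneg t)
  have hZ : t ∉ Z := fun hZ => by simp [h.eq_one t hZ] at hGt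
  obtain ⟨B, hB⟩ := h.gap_lip t hZ
  obtain ⟨r, hr, hball⟩ := Metric.eventually_nhds_iff.1 hB
  set B' := max B 1
  have hB'pos : 0 < B' := lt_max_of_lt_right one_pos
  set c := max a (t - r / 2)
  set d := min b (t + r / 2)
  have hcd : c < d := by
    simp only [c, d, max_lt_iff, lt_min_iff]
    refine ⟨⟨hab, ?_⟩, ?_, ?_⟩ <;> linarith [ht.1, ht.2]
  have hct : c ≤ t := max_le ht.1 (by linarith)
  have htd : t ≤ d := le_min ht.2 (by linarith)
  have hinteg : IntervalIntegrable (fun s => (s - t)⁻¹) volume c d := by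
    rw [intervalIntegrable_iff_integrableOn_Icc_of_le hcd.le]
    refine ⟨by fun_prop, ?_⟩
    rw [hasFiniteIntegral_iff_enorm]
    calc ∫⁻ s in Icc c d, ‖(s - t)⁻¹‖ₑ
        ≤ ∫⁻ s in Icc c d, ENNReal.ofReal B' * (ENNReal.ofReal (G s))⁻¹ := by
          refine setLIntegral_mono' measurableSet_Icc fun s hs => ?_
          have hsr : dist s t < r := by
            have h1 := (le_max_right a (t - r / 2)).trans hs.1
            have h2 := hs.2.trans (min_le_right b (t + r / 2))
            rw [Real.dist_eq, abs_lt]; constructor <;> linarith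
          have hG : G s ≤ B' * |s - t| := by
            have := hball hsr
            rw [hGt, sub_zero, Real.dist_eq] at this
            exact (le_abs_self _).trans (this.trans
              (mul_le_mul_of_nonneg_right (le_max_left _ _) (abs_nonneg _)))
          rcases eq_or_ne s t with rfl | hst
          · simp
          have hpos : 0 < |s - t| := abs_pos.2 (sub_ne_zero.2 hst)
          calc ‖(s - t)⁻¹‖ₑ = ENNReal.ofReal B' * (ENNReal.ofReal (B' * |s - t|))⁻¹ := by
                rw [← ENNReal.ofReal_inv_of_pos (by positivity), ← ENNReal.ofReal_mul hB'pos.le,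
                  ← ofReal_norm, norm_inv, Real.norm_eq_abs, mul_inv,
                  mul_inv_cancel_left₀ hB'pos.ne']
            _ ≤ _ := by gcongr
      _ = ENNReal.ofReal B' * ∫⁻ s in Icc c d, (ENNReal.ofReal (G s))⁻¹ :=
          lintegral_const_mul _ h.measurable_gap.ennreal_ofReal.inv
      _ ≤ ENNReal.ofReal B' * ∫⁻ s in Icc a b, (ENNReal.ofReal (G s))⁻¹ := by
          gcongr
          · exact le_max_left _ _
          · exact min_le_left _ _
      _ < ⊤ := ENNReal.mul_lt_top ENNReal.ofReal_lt_top hfin.lt_top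
  rcases intervalIntegrable_sub_inv_iff.1 hinteg with h1 | h1
  · exact hcd.ne h1
  · exact h1 (by rw [uIcc_of_le hcd.le]; exact ⟨hct, htd⟩)

lemma integrableOn_gapGradient (h : GapControlled Z F G M) {a b : ℝ}
    (hfin : ∫⁻ t in Icc a b, (ENNReal.ofReal (G t))⁻¹ ≠ ⊤) :
    IntegrableOn (gapGradient G M) (Icc a b) := by
  have h1 : IntegrableOn (fun t => (G t)⁻¹) (Icc a b) := by
    refine ⟨h.measurable_gap.inv.aestronglyMeasurable, ?_⟩
    rw [hasFiniteIntegral_iff_enorm]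
    exact (lintegral_mono fun t => enorm_inv_le_ofReal_inv (h.nonneg t)).trans_lt hfin.lt_top
  exact ((integrable_const (1 : ℝ)).add h1).const_mul M

private lemma dist_le_integral_of_disjoint (h : GapControlled Z F G M) {s t : ℝ} (hst : s ≤ t)
    (hpos : ∀ r ∈ Icc s t, 0 < G r) (hZ : ∀ r ∈ Icc s t, r ∉ Z) :
    dist (F s) (F t) ≤ ∫ r in s..t, gapGradient G M r := by
  have hcont : ContinuousOn (gapGradient G M) (Icc s t) := by
    refine continuousOn_const.mul (continuousOn_const.add (ContinuousOn.inv₀ ?_ ?_))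
    · exact fun r hr => (h.continuousAt_gap (hZ r hr)).continuousWithinAt
    · exact fun r hr => (hpos r hr).ne'
  set g := IccExtend hst ((Icc s t).domRestrict (gapGradient G M))
  have hg : Continuous g := (continuousOn_iff_continuous_domRestrict.1 hcont).Icc_extend'
  have hgeq : ∀ r ∈ Icc s t, g r = gapGradient G M r := fun r hr => by
    simp [g, IccExtend_of_mem hst _ hr, Set.domRestrict]
  have hFc : ContinuousOn F (Icc s t) := h.continuousOn_map hpos
  have key := image_le_of_liminf_slope_right_le_deriv_boundary
    (f := fun r => dist (F s) (F r)) (a := s) (b := t)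
    (B := fun r => ∫ x in s..r, g x) (B' := g)
    (fun r hr => tendsto_const_nhds.dist (hFc r hr).tendsto) (by simp)
    (fun r _ =>
      (hg.integral_hasStrictDerivAt s r).hasDerivAt.continuousAt.continuousWithinAt)
    (fun r _ => (hg.integral_hasStrictDerivAt s r).hasDerivAt.hasDerivWithinAt) ?_
    (right_mem_Icc.2 hst)
  · refine key.trans_eq (intervalIntegral.integral_congr fun r hr => ?_)
    rw [uIcc_of_le hst] at hr
    exact hgeq r hr
  · intro x hx r hr
    apply Eventually.frequently
    have hx' : x ∈ Icc s t := Ico_subset_Icc_self hx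
    filter_upwards [nhdsWithin_le_nhds (h.map_lip x (hZ x hx') (hpos x hx')),
      self_mem_nhdsWithin] with z hz hxz
    have hxz' : 0 < z - x := sub_pos.2 hxz
    refine lt_of_le_of_lt ?_ hr
    rw [slope_def_field, div_le_iff₀ hxz', hgeq x hx']
    calc dist (F s) (F z) - dist (F s) (F x) ≤ dist (F z) (F x) := by
          have := dist_triangle (F s) (F x) (F z)
          rw [dist_comm (F x)] at this; linarith
      _ ≤ M / G x * dist z x := hz
      _ ≤ gapGradient G M x * (z - x) := by
          rw [Real.dist_eq, abs_of_pos hxz']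
          exact mul_le_mul_of_nonneg_right (h.div_le_gapGradient x) hxz'.le

private lemma dist_le_integral_of_disjoint_Ioo (h : GapControlled Z F G M) {s t : ℝ} (hst : s ≤ t)
    (hpos : ∀ r ∈ Icc s t, 0 < G r) (hinteg : IntegrableOn (gapGradient G M) (Icc s t))
    (hZ : ∀ r ∈ Ioo s t, r ∉ Z) :
    dist (F s) (F t) ≤ ∫ r in s..t, gapGradient G M r := by
  rcases hst.eq_or_lt with rfl | hlt
  · simp
  have hFc : ContinuousOn F (Icc s t) := h.continuousOn_map hpos
  have hii : IntervalIntegrable (gapGradient G M) volume s t :=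
    (intervalIntegrable_iff_integrableOn_Icc_of_le hst).2 hinteg
  have h1 : ∀ s' ∈ Ioo s t, ∀ t' ∈ Ioo s t, s' ≤ t' →
      dist (F s') (F t') ≤ ∫ r in s..t, gapGradient G M r := by
    intro s' hs' t' ht' hle
    have hsub : Icc s' t' ⊆ Ioo s t := fun r hr =>
      ⟨hs'.1.trans_le hr.1, hr.2.trans_lt ht'.2⟩
    refine (h.dist_le_integral_of_disjoint hle (fun r hr => hpos r (Ioo_subset_Icc_self (hsub hr)))
      (fun r hr => hZ r (hsub hr))).trans ?_
    exact intervalIntegral.integral_mono_interval hs'.1.le hle ht'.2.le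
      (Eventually.of_forall fun r => h.gapGradient_nonneg r) hii
  have h2 : ∀ s' ∈ Ioo s t, dist (F s') (F t) ≤ ∫ r in s..t, gapGradient G M r := by
    intro s' hs'
    have hc : ContinuousWithinAt F (Iio t) t :=
      (hFc t (right_mem_Icc.2 hst)).mono_of_mem_nhdsWithin (Icc_mem_nhdsLT hlt)
    refine le_of_tendsto (tendsto_const_nhds.dist hc.tendsto) ?_
    filter_upwards [Ioo_mem_nhdsLT hs'.2] with t' ht'
    exact h1 s' hs' t' ⟨hs'.1.trans ht'.1, ht'.2⟩ ht'.1.le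
  have hc : ContinuousWithinAt F (Ioi s) s :=
    (hFc s (left_mem_Icc.2 hst)).mono_of_mem_nhdsWithin (Icc_mem_nhdsGT hlt)
  refine le_of_tendsto (hc.tendsto.dist tendsto_const_nhds) ?_
  filter_upwards [Ioo_mem_nhdsGT hlt] with s' hs'
  exact h2 s' hs'

/-- `gapGradient` is an upper gradient of `F` along intervals where it is integrable. -/
lemma dist_le_integral (h : GapControlled Z F G M) {s t : ℝ} (hst : s ≤ t)
    (hpos : ∀ r ∈ Icc s t, 0 < G r) (hinteg : IntegrableOn (gapGradient G M) (Icc s t)) :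
    dist (F s) (F t) ≤ ∫ r in s..t, gapGradient G M r := by
  by_cases hne : (Icc s t ∩ Z).Nonempty
  · have hK : IsCompact (Icc s t ∩ Z) := isCompact_Icc.inter_right h.isClosed
    set s' := sInf (Icc s t ∩ Z)
    set t' := sSup (Icc s t ∩ Z)
    have hs' : s' ∈ Icc s t ∩ Z := hK.sInf_mem hne
    have ht' : t' ∈ Icc s t ∩ Z := hK.sSup_mem hne
    have hst' : s' ≤ t' := csInf_le hK.bddBelow ht'
    have hii : ∀ x ∈ Icc s t, ∀ y ∈ Icc s t, x ≤ y →
        IntegrableOn (gapGradient G M) (Icc x y) := fun x hx y hy _ =>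
      hinteg.mono_set (Icc_subset_Icc hx.1 hy.2)
    have hiv : ∀ x ∈ Icc s t, ∀ y ∈ Icc s t, x ≤ y →
        IntervalIntegrable (gapGradient G M) volume x y := fun x hx y hy hxy =>
      (intervalIntegrable_iff_integrableOn_Icc_of_le hxy).2 (hii x hx y hy hxy)
    have hsm := left_mem_Icc.2 hst
    have htm := right_mem_Icc.2 hst
    have e1 : dist (F s) (F s') ≤ ∫ r in s..s', gapGradient G M r := by
      refine h.dist_le_integral_of_disjoint_Ioo hs'.1.1
        (fun r hr => hpos r ⟨hr.1, hr.2.trans hs'.1.2⟩) (hii _ hsm _ hs'.1 hs'.1.1) ?_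
      intro r hr hrZ
      exact (not_le.2 hr.2) (csInf_le hK.bddBelow ⟨⟨hr.1.le, hr.2.le.trans hs'.1.2⟩, hrZ⟩)
    have e3 : dist (F t') (F t) ≤ ∫ r in t'..t, gapGradient G M r := by
      refine h.dist_le_integral_of_disjoint_Ioo ht'.1.2
        (fun r hr => hpos r ⟨ht'.1.1.trans hr.1, hr.2⟩) (hii _ ht'.1 _ htm ht'.1.2) ?_
      intro r hr hrZ
      exact (not_le.2 hr.1) (le_csSup hK.bddAbove ⟨⟨ht'.1.1.trans hr.1.le, hr.2.le⟩, hrZ⟩)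
    have e2 : dist (F s') (F t') ≤ ∫ r in s'..t', gapGradient G M r := by
      calc dist (F s') (F t') ≤ M * dist s' t' := h.map_lip_core _ (hpos _ hs'.1) _ ht'.2
        _ = ∫ _ in s'..t', M := by
            rw [intervalIntegral.integral_const, dist_comm, Real.dist_eq,
              abs_of_nonneg (sub_nonneg.2 hst'), smul_eq_mul, mul_comm]
        _ ≤ _ := intervalIntegral.integral_mono_on hst' (by simp)
            (hiv _ hs'.1 _ ht'.1 hst') fun r _ => h.le_gapGradient r
    have hsum := intervalIntegral.integral_add_adjacent_intervals
      (hiv _ hsm _ hs'.1 hs'.1.1) (hiv _ hs'.1 _ ht'.1 hst')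
    have hsum' := intervalIntegral.integral_add_adjacent_intervals
      (hiv _ hsm _ ht'.1 ht'.1.1) (hiv _ ht'.1 _ htm ht'.1.2)
    have := dist_triangle4 (F s) (F s') (F t') (F t)
    linarith
  · exact h.dist_le_integral_of_disjoint hst hpos
      fun r hr hrZ => hne ⟨r, hr, hrZ⟩

end GapControlled

section Lines

variable {E : Type*} [NormedAddCommGroup E] [NormedSpace ℝ E] [FiniteDimensional ℝ E]
  [MeasurableSpace E] [BorelSpace E] (μ : Measure E) [μ.IsAddHaarMeasure]

lemma quasiMeasurePreserving_add_smul (e : E) (a b : ℝ) :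
    Measure.QuasiMeasurePreserving (fun z : E × ℝ => z.1 + z.2 • e)
      (μ.prod (volume.restrict (Icc a b))) μ :=
  QuasiMeasurePreserving.prod_of_left (by fun_prop) (Eventually.of_forall fun t =>
    (measurePreserving_add_right μ (t • e)).quasiMeasurePreserving)

/-- A function of finite integral has finite integral on bounded pieces of almost every line
in a given direction. -/
lemma ae_lintegral_line_ne_top (e : E) {q : E → ENNReal} (hq : Measurable q)
    (hfin : ∫⁻ x, q x ∂μ ≠ ⊤) :
    ∀ᵐ y ∂μ, ∀ N : ℕ, ∫⁻ t in Icc (-(N : ℝ)) N, q (y + t • e) ≠ ⊤ := by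
  rw [ae_all_iff]
  intro N
  have hm : Measurable (Function.uncurry fun (y : E) (t : ℝ) => q (y + t • e)) :=
    hq.comp (by fun_prop : Measurable fun z : E × ℝ => z.1 + z.2 • e)
  have hswap := lintegral_lintegral_swap (μ := μ)
    (ν := volume.restrict (Icc (-(N : ℝ)) N)) hm.aemeasurable
  simp_rw [lintegral_add_right_eq_self q] at hswap
  have : ∫⁻ y, (∫⁻ t in Icc (-(N : ℝ)) N, q (y + t • e)) ∂μ ≠ ⊤ := by
    rw [hswap]
    simpa using ENNReal.mul_ne_top hfin (by simp)
  filter_upwards [ae_lt_top hm.lintegral_prod_right' this] with y hy using hy.ne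

lemma integrable_prod_line (e : E) {Φ : E → ℝ} (hΦ : Integrable Φ μ) (a b : ℝ) :
    Integrable (fun z : E × ℝ => Φ (z.1 + z.2 • e)) (μ.prod (volume.restrict (Icc a b))) := by
  have hm : AEStronglyMeasurable (fun z : E × ℝ => Φ (z.1 + z.2 • e))
      (μ.prod (volume.restrict (Icc a b))) :=
    hΦ.aestronglyMeasurable.comp_quasiMeasurePreserving (quasiMeasurePreserving_add_smul μ e a b)
  rw [integrable_prod_iff' hm]
  refine ⟨Eventually.of_forall fun t => hΦ.comp_add_right (t • e), ?_⟩
  simp_rw [integral_add_right_eq_self (fun x => ‖Φ x‖)]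
  simp

lemma ae_intervalIntegrable_line (e : E) {Φ : E → ℝ} (hΦ : Integrable Φ μ) :
    ∀ᵐ y ∂μ, ∀ a b : ℝ, IntervalIntegrable (fun t : ℝ => Φ (y + t • e)) volume a b := by
  have h1 : ∀ᵐ y ∂μ, ∀ N : ℕ, Integrable (fun t : ℝ => Φ (y + t • e))
      (volume.restrict (Icc (-(N : ℝ)) N)) := by
    rw [ae_all_iff]
    exact fun N => (integrable_prod_line μ e hΦ _ _).prod_right_ae
  filter_upwards [h1] with y hy a b
  obtain ⟨N, hN⟩ := exists_nat_ge (max |a| |b|)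
  have ha := abs_le.1 ((le_max_left _ _).trans hN)
  have hb := abs_le.1 ((le_max_right _ _).trans hN)
  refine intervalIntegrable_iff.2 ((hy N).mono_measure (Measure.restrict_mono ?_ le_rfl))
  refine (uIoc_subset_uIcc).trans (uIcc_subset_Icc ⟨ha.1, ha.2⟩ ⟨hb.1, hb.2⟩)

/-- The classical directional derivative of `u` along `e`. -/
def dirDeriv (u : E → ℝ) (e x : E) : ℝ := deriv (fun t : ℝ => u (x + t • e)) 0

omit [FiniteDimensional ℝ E] [MeasurableSpace E] [BorelSpace E] in
lemma dirDeriv_add_smul (u : E → ℝ) (e y : E) (t : ℝ) :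
    dirDeriv u e (y + t • e) = deriv (fun s : ℝ => u (y + s • e)) t := by
  have h := deriv_comp_const_add (f := fun s : ℝ => u (y + s • e)) t 0
  rw [add_zero] at h
  rw [← h, dirDeriv]
  congr 1
  ext s
  rw [add_assoc, ← add_smul]

/-- `u` is absolutely continuous on compact segments in `Ω` of the line through `y` in
direction `e`. -/
def ACAlong (Ω : Set E) (u : E → ℝ) (e y : E) : Prop :=
  ∀ a b : ℝ, a < b → (∀ t ∈ Icc a b, y + t • e ∈ Ω) →
    AbsolutelyContinuousOnInterval (fun t : ℝ => u (y + t • e)) a b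

omit [FiniteDimensional ℝ E] [MeasurableSpace E] [BorelSpace E] in
lemma exists_segment_subset {Ω : Set E} (hΩ : IsOpen Ω) {e y : E} {t : ℝ} (ht : y + t • e ∈ Ω) :
    ∃ r > 0, ∀ s ∈ Icc (t - r) (t + r), y + s • e ∈ Ω := by
  have hc : Continuous fun s : ℝ => y + s • e := by fun_prop
  obtain ⟨r, hr, hball⟩ := Metric.isOpen_iff.1 (hΩ.preimage hc) t ht
  refine ⟨r / 2, by positivity, fun s hs => hball ?_⟩
  rw [Metric.mem_ball, Real.dist_eq, abs_lt]
  constructor <;> linarith [hs.1, hs.2]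

omit [FiniteDimensional ℝ E] [MeasurableSpace E] [BorelSpace E] in
lemma ACAlong.ae_differentiableAt {Ω : Set E} (hΩ : IsOpen Ω) {u : E → ℝ} {e y : E}
    (h : ACAlong Ω u e y) :
    ∀ᵐ t : ℝ, y + t • e ∈ Ω → DifferentiableAt ℝ (fun t : ℝ => u (y + t • e)) t := by
  have h1 : ∀ᵐ t : ℝ, ∀ a b : ℚ, (a : ℝ) < b → (∀ t ∈ Icc (a : ℝ) b, y + t • e ∈ Ω) →
      t ∈ Icc (a : ℝ) b → DifferentiableAt ℝ (fun t : ℝ => u (y + t • e)) t := by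
    simp_rw [ae_all_iff]
    intro a b hab hseg
    filter_upwards [(h a b hab hseg).ae_differentiableAt] with t ht hmem
    exact ht (by rwa [uIcc_of_le hab.le])
  filter_upwards [h1] with t ht hmem
  obtain ⟨r, hr, hseg⟩ := exists_segment_subset hΩ hmem
  obtain ⟨a, ha1, ha2⟩ := exists_rat_btwn (show t - r < t by linarith)
  obtain ⟨b, hb1, hb2⟩ := exists_rat_btwn (show t < t + r by linarith)
  exact ht a b (ha2.trans hb1) (fun s hs => hseg s ⟨ha1.le.trans hs.1, hs.2.trans hb2.le⟩)
    ⟨ha2.le, hb1.le⟩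

omit [FiniteDimensional ℝ E] [MeasurableSpace E] [BorelSpace E] in
lemma ACAlong.continuousOn {Ω : Set E} {u : E → ℝ} {e y : E}
    (h : ACAlong Ω u e y) {a b : ℝ} (hab : a < b) (hseg : ∀ t ∈ Icc a b, y + t • e ∈ Ω) :
    ContinuousOn (fun t : ℝ => u (y + t • e)) (Icc a b) := by
  have := (h a b hab hseg).continuousOn
  rwa [uIcc_of_le hab.le] at this

/-- The filter of nonzero rationals tending to zero. -/
def ratPunctured : Filter ℚ := comap ((↑) : ℚ → ℝ) (𝓝[≠] 0)

instance : ratPunctured.IsCountablyGenerated := by unfold ratPunctured; infer_instance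

/-- For a function continuous near `0`, rational difference quotients detect the derivative. -/
lemma hasDerivAt_of_tendsto_rat {ψ : ℝ → ℝ} {r c : ℝ} (hr : 0 < r)
    (hψ : ContinuousOn ψ (Icc (-r) r))
    (hc : Tendsto (fun q : ℚ => (ψ q - ψ 0) / q) ratPunctured (𝓝 c)) : HasDerivAt ψ c 0 := by
  rw [hasDerivAt_iff_tendsto_slope, Metric.tendsto_nhds]
  intro ε hε
  have h1 := Metric.tendsto_nhds.1 hc (ε / 2) (by positivity)
  rw [ratPunctured, eventually_comap, eventually_nhdsWithin_iff, Metric.eventually_nhds_iff] at h1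
  obtain ⟨δ, hδ, h1⟩ := h1
  rw [eventually_nhdsWithin_iff, Metric.eventually_nhds_iff]
  refine ⟨min δ r, lt_min hδ hr, fun t ht ht0 => ?_⟩
  by_contra hcon
  rw [not_lt] at hcon
  have htabs : |t| < min δ r := by simpa [Real.dist_eq] using ht
  have htr := abs_lt.1 (htabs.trans_le (min_le_right _ _))
  have hct : ContinuousAt (fun s : ℝ => (ψ s - ψ 0) / s) t :=
    ((hψ.continuousAt (Icc_mem_nhds htr.1 htr.2)).sub continuousAt_const).div continuousAt_id ht0
  have hev : ∀ᶠ s in 𝓝 t, ε / 2 < dist ((ψ s - ψ 0) / s) c := by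
    refine (hct.dist continuousAt_const).eventually (lt_mem_nhds ?_)
    simp only [slope_def_field, sub_zero] at hcon
    linarith
  have hev2 : ∀ᶠ s in 𝓝 t, s ≠ 0 ∧ |s| < δ :=
    (eventually_ne_nhds ht0).and
      (continuous_abs.continuousAt.eventually_lt_const (htabs.trans_le (min_le_left _ _)))
  obtain ⟨U, hU, hUo, htU⟩ := _root_.eventually_nhds_iff.1 (hev.and hev2)
  obtain ⟨s, hsU, q, rfl⟩ := Rat.denseRange_cast.inter_open_nonempty U hUo ⟨t, htU⟩
  obtain ⟨h3, h4, h5⟩ := hU _ hsU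
  exact (h1 (by rwa [Real.dist_eq, sub_zero]) h4 q rfl).not_gt h3

section ACL

variable {μ} {Ω : Set E} (hΩ : IsOpen Ω) {u : E → ℝ} {e : E} (hum : Measurable (Ω.indicator u))
  (hAC : ∀ᵐ y ∂μ, ACAlong Ω u e y)

include hΩ hum hAC

/-- A function that is absolutely continuous along almost every line is almost everywhere
differentiable in the direction of the lines. -/
lemma ae_hasDerivAt_of_ACAlong :
    ∀ᵐ x ∂(μ.restrict Ω), HasDerivAt (fun t : ℝ => u (x + t • e)) (dirDeriv u e x) 0 := by
  set v := Ω.indicator u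
  set A : Set E := {x | ∃ c, Tendsto (fun q : ℚ => (v (x + (q : ℝ) • e) - v x) / (q : ℝ))
    ratPunctured (𝓝 c)}
  have hA : MeasurableSet A := measurableSet_exists_tendsto fun q =>
    ((hum.comp (measurable_add_const _)).sub hum).div_const _
  have key : ∀ x ∈ Ω, ∀ᶠ q : ℚ in ratPunctured, (v (x + (q : ℝ) • e) - v x) / (q : ℝ) =
      (u (x + (q : ℝ) • e) - u x) / (q : ℝ) := by
    intro x hx
    obtain ⟨r, hr, hseg⟩ := exists_segment_subset (y := x) (t := 0) (e := e) hΩ (by simpa using hx)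
    have hev : ∀ᶠ q : ℚ in ratPunctured, (q : ℝ) ∈ Icc (-r) r :=
      preimage_mem_comap (mem_nhdsWithin_of_mem_nhds (Icc_mem_nhds (neg_lt_zero.2 hr) hr))
    filter_upwards [hev] with q hq
    simp only [v]
    rw [indicator_of_mem hx, indicator_of_mem (hseg _ (by simpa using hq))]
  have hAΩ : ∀ᵐ x ∂μ, x ∈ Ωᶜ ∪ A := by
    rw [← ae_ae_add_linearMap_mem_iff (LinearMap.toSpanSingleton ℝ E e) volume μ
      (hΩ.measurableSet.compl.union hA)]
    filter_upwards [hAC] with y hy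
    filter_upwards [hy.ae_differentiableAt hΩ] with t ht
    rw [LinearMap.toSpanSingleton_apply]
    by_cases hmem : y + t • e ∈ Ω
    · right
      have hd := (ht hmem).hasDerivAt
      rw [← dirDeriv_add_smul] at hd
      refine ⟨_, Tendsto.congr' ((key _ hmem).mono fun q hq => hq.symm)
        (?_ : Tendsto _ _ (𝓝 (dirDeriv u e (y + t • e))))⟩
      have h2 := (hasDerivAt_iff_tendsto_slope_zero.1 hd).comp
        (tendsto_comap : Tendsto ((↑) : ℚ → ℝ) ratPunctured (𝓝[≠] 0))
      refine h2.congr fun q => ?_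
      simp only [Function.comp_apply, smul_eq_mul, add_smul, add_assoc]
      rw [inv_mul_eq_div]
    · exact Or.inl hmem
  rw [ae_restrict_iff' hΩ.measurableSet]
  filter_upwards [hAΩ, hAC] with x hx hxAC hxΩ
  obtain ⟨c, hc⟩ := hx.resolve_left (fun h => h hxΩ)
  obtain ⟨r, hr, hseg⟩ := exists_segment_subset (y := x) (t := 0) (e := e) hΩ (by simpa using hxΩ)
  rw [zero_sub, zero_add] at hseg
  have hder : HasDerivAt (fun t : ℝ => u (x + t • e)) c 0 := by
    refine hasDerivAt_of_tendsto_rat hr (hxAC.continuousOn (by linarith) hseg) ?_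
    simpa using hc.congr' (key x hxΩ)
  rw [dirDeriv, hder.deriv]
  exact hder

lemma aemeasurable_dirDeriv : AEMeasurable (dirDeriv u e) (μ.restrict Ω) := by
  set v := Ω.indicator u
  have hseq : Tendsto (fun n : ℕ => ((n : ℝ) + 1)⁻¹) atTop (𝓝[≠] 0) := by
    refine tendsto_nhdsWithin_iff.2 ⟨?_, Eventually.of_forall fun n => ?_⟩
    · simpa [one_div] using tendsto_one_div_add_atTop_nhds_zero_nat (𝕜 := ℝ)
    · exact (inv_pos.2 (by positivity : (0 : ℝ) < n + 1)).ne'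
  refine aemeasurable_of_tendsto_metrizable_ae atTop
    (f := fun (n : ℕ) x => ((n : ℝ) + 1)⁻¹⁻¹ * (v (x + ((n : ℝ) + 1)⁻¹ • e) - v x))
    (fun n => ((((hum.comp (measurable_add_const _)).sub hum)).const_mul _).aemeasurable) ?_
  have h1 := ae_hasDerivAt_of_ACAlong hΩ hum hAC
  rw [ae_restrict_iff' hΩ.measurableSet] at h1 ⊢
  filter_upwards [h1] with x hx hxΩ
  have h2 := (hasDerivAt_iff_tendsto_slope_zero.1 (hx hxΩ)).comp hseq
  refine h2.congr' ?_
  obtain ⟨r, hr, hseg⟩ := exists_segment_subset (y := x) (t := 0) (e := e) hΩ (by simpa using hxΩ)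
  filter_upwards [(tendsto_nhdsWithin_iff.1 hseq).1.eventually
    (Icc_mem_nhds (neg_lt_zero.2 hr) hr)] with n hn
  simp only [Function.comp_apply, smul_eq_mul, v, zero_add, zero_smul, add_zero]
  rw [indicator_of_mem hxΩ, indicator_of_mem (hseg _ (by simpa using hn))]

omit hum in
/-- Integration by parts for functions absolutely continuous along almost every line. -/
lemma integral_mul_fderiv_of_ACAlong (hu : IntegrableOn u Ω μ)
    (hw : IntegrableOn (dirDeriv u e) Ω μ) {φ : E → ℝ} (hφ : ContDiff ℝ (⊤ : ℕ∞) φ)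
    (hφc : HasCompactSupport φ) (hφΩ : tsupport φ ⊆ Ω) :
    ∫ x in Ω, u x * fderiv ℝ φ x e ∂μ = - ∫ x in Ω, dirDeriv u e x * φ x ∂μ := by
  have hφ1 : ContDiff ℝ 1 φ := hφ.of_le (by exact_mod_cast le_top)
  have hdφ : Continuous fun x => fderiv ℝ φ x e := (hφ1.continuous_fderiv one_ne_zero).clm_apply
    continuous_const
  have hφ0 : ∀ x ∉ tsupport φ, φ x = 0 := fun x hx => image_eq_zero_of_notMem_tsupport hx
  have hdφ0 : ∀ x ∉ tsupport φ, fderiv ℝ φ x e = 0 := fun x hx => by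
    have : x ∉ tsupport (fderiv ℝ φ) := fun h => hx (tsupport_fderiv_subset ℝ h)
    rw [image_eq_zero_of_notMem_tsupport this]; rfl
  have hdφc : HasCompactSupport fun x => fderiv ℝ φ x e :=
    hφc.of_isClosed_subset (isClosed_tsupport _) (closure_minimal (fun x hx => by
      by_contra h; exact hx (hdφ0 x h)) (isClosed_tsupport _))
  obtain ⟨B1, hB1⟩ := hφ.continuous.bounded_above_of_compact_support hφc
  obtain ⟨B2, hB2⟩ := hdφ.bounded_above_of_compact_support hdφc
  have i1 : IntegrableOn (fun x => u x * fderiv ℝ φ x e) Ω μ :=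
    Integrable.mul_bdd (c := B2) hu hdφ.aestronglyMeasurable (Eventually.of_forall hB2)
  have i2 : IntegrableOn (fun x => dirDeriv u e x * φ x) Ω μ :=
    Integrable.mul_bdd (c := B1) hw hφ.continuous.aestronglyMeasurable (Eventually.of_forall hB1)
  have i3 : IntegrableOn (fun x => u x * φ x) Ω μ :=
    Integrable.mul_bdd (c := B1) hu hφ.continuous.aestronglyMeasurable (Eventually.of_forall hB1)
  set Φ : E → ℝ := fun x => dirDeriv u e x * φ x + u x * fderiv ℝ φ x e
  set W : E → ℝ := fun x => u x * φ x
  have hΦ0 : ∀ x ∉ tsupport φ, Φ x = 0 := fun x hx => by simp [Φ, hφ0 x hx, hdφ0 x hx]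
  have hW0 : ∀ x ∉ tsupport φ, W x = 0 := fun x hx => by simp [W, hφ0 x hx]
  have hΦi : Integrable Φ μ := (integrableOn_iff_integrable_of_support_subset fun x hx =>
    hφΩ (by by_contra h; exact hx (hΦ0 x h))).1 (i2.add i1)
  have hWi : Integrable W μ := (integrableOn_iff_integrable_of_support_subset fun x hx =>
    hφΩ (by by_contra h; exact hx (hW0 x h))).1 i3
  have hline : ∀ᵐ y ∂μ, W (y + (1 : ℝ) • e) - W y = ∫ t in (0 : ℝ)..1, Φ (y + t • e) := by
    filter_upwards [hAC, ae_intervalIntegrable_line μ e hΦi] with y hy hinteg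
    have hloc : IsLocallyConstant fun t : ℝ =>
        W (y + t • e) - ∫ s in (0 : ℝ)..t, Φ (y + s • e) := by
      rw [IsLocallyConstant.iff_eventually_eq]
      intro t
      have hc : Continuous fun s : ℝ => y + s • e := by fun_prop
      suffices h : ∀ᶠ s in 𝓝 t, W (y + s • e) - W (y + t • e) =
          ∫ r in t..s, Φ (y + r • e) by
        filter_upwards [h] with s hs
        have := intervalIntegral.integral_add_adjacent_intervals (hinteg 0 t) (hinteg t s)
        linarith
      by_cases htΩ : y + t • e ∈ Ω
      · obtain ⟨r, hr, hseg⟩ := exists_segment_subset hΩ htΩ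
        filter_upwards [Icc_mem_nhds (show t - r < t by linarith) (show t < t + r by linarith)]
          with s hs
        have hsub : uIcc t s ⊆ uIcc (t - r) (t + r) := by
          rw [uIcc_of_le (by linarith : t - r ≤ t + r)]
          exact uIcc_subset_Icc ⟨by linarith, by linarith⟩ hs
        have hac := (hy _ _ (by linarith) hseg).mono hsub
        have hφl : ContDiff ℝ 1 fun s : ℝ => φ (y + s • e) := hφ1.comp (by fun_prop)
        have hac2 : AbsolutelyContinuousOnInterval (fun s : ℝ => φ (y + s • e)) t s :=
          hφl.contDiffOn.absolutelyContinuousOnInterval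
        rw [← hac.integral_deriv_mul_eq_sub hac2]
        refine intervalIntegral.integral_congr fun r _ => ?_
        have hd : deriv (fun s : ℝ => φ (y + s • e)) r = fderiv ℝ φ (y + r • e) e := by
          have h1 : HasDerivAt (fun s : ℝ => y + s • e) e r := by
            simpa using ((hasDerivAt_id r).smul_const e).const_add y
          exact (((hφ1.differentiable one_ne_zero) _).hasFDerivAt.comp_hasDerivAt r h1).deriv
        simp only [Φ]
        rw [hd, dirDeriv_add_smul]
      · have hnot : y + t • e ∉ tsupport φ := fun h => htΩ (hφΩ h)
        obtain ⟨r, hr, hseg⟩ := exists_segment_subset (isClosed_tsupport φ).isOpen_compl hnot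
        filter_upwards [Icc_mem_nhds (show t - r < t by linarith) (show t < t + r by linarith)]
          with s hs
        rw [hW0 _ (hseg s hs), hW0 _ hnot, sub_zero, eq_comm]
        refine intervalIntegral.integral_zero_ae (Eventually.of_forall fun q hq => hΦ0 _ (hseg q ?_))
        exact uIcc_subset_Icc ⟨by linarith, by linarith⟩ hs (uIoc_subset_uIcc hq)
    have := hloc.apply_eq_of_preconnectedSpace 1 0
    simp only [intervalIntegral.integral_same, zero_smul, add_zero, sub_zero] at this
    linarith
  have hzero : ∫ x, Φ x ∂μ = 0 := by
    have h1 : ∫ y, (W (y + (1 : ℝ) • e) - W y) ∂μ = 0 := by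
      rw [integral_sub (hWi.comp_add_right _) hWi, integral_add_right_eq_self W, sub_self]
    have h2 : ∫ y, (∫ t in Icc (0 : ℝ) 1, Φ (y + t • e)) ∂μ = ∫ x, Φ x ∂μ := by
      rw [integral_integral_swap (integrable_prod_line μ e hΦi 0 1)]
      simp_rw [integral_add_right_eq_self Φ]
      simp
    rw [← h2]
    refine (integral_congr_ae ?_).trans h1
    filter_upwards [hline] with y hy
    rw [hy, intervalIntegral.integral_of_le zero_le_one, integral_Icc_eq_integral_Ioc]
  have hsplit : ∫ x in Ω, Φ x ∂μ =
      (∫ x in Ω, dirDeriv u e x * φ x ∂μ) + ∫ x in Ω, u x * fderiv ℝ φ x e ∂μ :=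
    integral_add i2 i1
  rw [setIntegral_eq_integral_of_forall_compl_eq_zero
    fun x hx => hΦ0 x fun h => hx (hφΩ h), hzero] at hsplit
  linarith

end ACL

end Lines

lemma ACOn.of_absolutelyContinuousOnInterval {u : ℝ → ℝ} {a b : ℝ} (hab : a ≤ b)
    (h : AbsolutelyContinuousOnInterval u a b) : ACOn u a b := by
  refine ⟨deriv u, h.intervalIntegrable_deriv, fun x hx => ?_⟩
  have hsub : uIcc a x ⊆ uIcc a b := by
    rw [uIcc_of_le hab, uIcc_of_le hx.1]; exact Icc_subset_Icc_right hx.2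
  rw [(h.mono hsub).integral_deriv_eq_sub]
  ring

lemma AbsolutelyContinuousOnInterval.of_dist_le_integral {X : Type*} [PseudoMetricSpace X]
    {ψ : ℝ → X} {g : ℝ → ℝ} {a b : ℝ} (hab : a ≤ b) (hg : IntegrableOn g (Icc a b))
    (h : ∀ s t, a ≤ s → s ≤ t → t ≤ b → dist (ψ s) (ψ t) ≤ ∫ r in s..t, g r) :
    AbsolutelyContinuousOnInterval ψ a b := by
  have hgi : IntervalIntegrable g volume a b :=
    (intervalIntegrable_iff_integrableOn_Icc_of_le hab).2 hg
  have hac := hgi.absolutelyContinuousOnInterval_intervalIntegral (c := a) (by simp)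
  have key : ∀ s ∈ Icc a b, ∀ t ∈ Icc a b,
      dist (ψ s) (ψ t) ≤ dist (∫ r in a..s, g r) (∫ r in a..t, g r) := by
    have haux : ∀ s t, a ≤ s → s ≤ t → t ≤ b →
        dist (ψ s) (ψ t) ≤ dist (∫ r in a..s, g r) (∫ r in a..t, g r) := by
      intro s t h1 h2 h3
      have hs : IntervalIntegrable g volume a s := hgi.mono_set (by
        rw [uIcc_of_le hab, uIcc_of_le h1]; exact Icc_subset_Icc_right (h2.trans h3))
      have hst : IntervalIntegrable g volume s t := hgi.mono_set (by
        rw [uIcc_of_le hab, uIcc_of_le h2]; exact Icc_subset_Icc h1 h3)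
      rw [dist_comm (∫ r in a..s, g r), Real.dist_eq,
        ← intervalIntegral.integral_add_adjacent_intervals hs hst, add_sub_cancel_left]
      exact (h s t h1 h2 h3).trans (le_abs_self _)
    intro s hs t ht
    rcases le_total s t with hst | hst
    · exact haux s t hs.1 hst ht.2
    · rw [dist_comm, dist_comm (∫ r in a..s, g r)]
      exact haux t s ht.1 hst hs.2
  rw [absolutelyContinuousOnInterval_iff] at hac ⊢
  intro ε hε
  obtain ⟨δ, hδ, hacδ⟩ := hac ε hε
  refine ⟨δ, hδ, fun E hE hlen => (Finset.sum_le_sum fun i hi => ?_).trans_lt (hacδ E hE hlen)⟩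
  have hmem := hE.1 i hi
  rw [uIcc_of_le hab] at hmem
  exact key _ hmem.1 _ hmem.2

lemma AbsolutelyContinuousOnInterval.comp_lipschitz {Y : Type*} [PseudoMetricSpace Y]
    {ψ : ℝ → Y} {φ : Y → ℝ} {K a b : ℝ} (hφ : ∀ x y, |φ x - φ y| ≤ K * dist x y)
    (h : AbsolutelyContinuousOnInterval ψ a b) :
    AbsolutelyContinuousOnInterval (fun t => φ (ψ t)) a b := by
  have h2 : Tendsto (fun E : ℕ × (ℕ → ℝ × ℝ) => K * ∑ i ∈ Finset.range E.1,
      dist (ψ (E.2 i).1) (ψ (E.2 i).2)) (AbsolutelyContinuousOnInterval.totalLengthFilter ⊓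
        𝓟 (AbsolutelyContinuousOnInterval.disjWithin a b)) (𝓝 0) := by
    simpa using Tendsto.const_mul K h
  refine squeeze_zero (fun E => by positivity) (fun E => ?_) h2
  rw [Finset.mul_sum]
  exact Finset.sum_le_sum fun i _ => hφ _ _

namespace GapControlled

section Global

variable {m : ℕ} {Y : Type*} [PseudoMetricSpace Y] {Z Ω : Set (Euc m)} {F : Euc m → Y}
  {G : Euc m → ℝ} {M p : ℝ}

lemma lintegral_inv_gap_ne_top (hp : 1 ≤ p) (hΩb : volume Ω ≠ ⊤)
    (hfin : ∫⁻ x in Ω, (ENNReal.ofReal (G x))⁻¹ ^ p ≠ ⊤) :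
    ∫⁻ x in Ω, (ENNReal.ofReal (G x))⁻¹ ≠ ⊤ := by
  refine ne_top_of_le_ne_top (b := volume Ω + ∫⁻ x in Ω, (ENNReal.ofReal (G x))⁻¹ ^ p)
    (ENNReal.add_ne_top.2 ⟨hΩb, hfin⟩) ?_
  calc ∫⁻ x in Ω, (ENNReal.ofReal (G x))⁻¹
      ≤ ∫⁻ x in Ω, (1 + (ENNReal.ofReal (G x))⁻¹ ^ p) := lintegral_mono fun x => by
        rcases le_total ((ENNReal.ofReal (G x))⁻¹) 1 with h | h
        · exact h.trans le_self_add
        · calc (ENNReal.ofReal (G x))⁻¹ = (ENNReal.ofReal (G x))⁻¹ ^ (1 : ℝ) := by simp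
            _ ≤ (ENNReal.ofReal (G x))⁻¹ ^ p := ENNReal.rpow_le_rpow_of_exponent_le h hp
            _ ≤ _ := le_add_self
    _ = _ := by rw [lintegral_add_left measurable_const]; simp

lemma isometry_add_smul {e : Euc m} (he : ‖e‖ = 1) (y : Euc m) :
    Isometry fun t : ℝ => y + t • e := by
  refine Isometry.of_dist_eq fun s t => ?_
  rw [dist_add_left, dist_eq_norm, ← sub_smul, norm_smul, he, mul_one, Real.dist_eq,
    Real.norm_eq_abs]

/-- Along almost every line, the gap is positive and the gradient integrable on compact segments
inside `Ω`. -/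
lemma ae_line (h : GapControlled Z F G M) (hΩo : IsOpen Ω)
    (hfin : ∫⁻ x in Ω, (ENNReal.ofReal (G x))⁻¹ ≠ ⊤) (e : Euc m) (he : ‖e‖ = 1) :
    ∀ᵐ y : Euc m, ∀ a b : ℝ, a < b → (∀ t ∈ Icc a b, y + t • e ∈ Ω) →
      (∀ t ∈ Icc a b, 0 < G (y + t • e)) ∧
      AbsolutelyContinuousOnInterval (fun t : ℝ => F (y + t • e)) a b := by
  have hq : Measurable (Ω.indicator fun x => (ENNReal.ofReal (G x))⁻¹) :=
    (h.measurable_gap.ennreal_ofReal.inv).indicator hΩo.measurableSet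
  rw [← lintegral_indicator hΩo.measurableSet] at hfin
  filter_upwards [ae_lintegral_line_ne_top volume e hq hfin] with y hy a b hab hseg
  obtain ⟨N, hN⟩ := exists_nat_ge (max |a| |b|)
  have ha := abs_le.1 ((le_max_left _ _).trans hN)
  have hb := abs_le.1 ((le_max_right _ _).trans hN)
  have hl := h.comp_isometry (isometry_add_smul he y)
  have hfin' : ∫⁻ t in Icc a b, (ENNReal.ofReal ((G ∘ fun t : ℝ => y + t • e) t))⁻¹ ≠ ⊤ := by
    refine ne_top_of_le_ne_top (hy N) ?_
    calc ∫⁻ t in Icc a b, (ENNReal.ofReal ((G ∘ fun t : ℝ => y + t • e) t))⁻¹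
        = ∫⁻ t in Icc a b, Ω.indicator (fun x => (ENNReal.ofReal (G x))⁻¹) (y + t • e) :=
          setLIntegral_congr_fun measurableSet_Icc fun t ht => by
            simp [indicator_of_mem (hseg t ht)]
      _ ≤ _ := lintegral_mono_set (Icc_subset_Icc ha.1 hb.2)
  have hpos := hl.pos_of_lintegral_ne_top hab hfin'
  have hinteg := hl.integrableOn_gapGradient hfin'
  refine ⟨hpos, .of_dist_le_integral hab.le hinteg fun s t hs hst ht => ?_⟩
  have hsub : Icc s t ⊆ Icc a b := Icc_subset_Icc hs ht
  exact hl.dist_le_integral hst (fun r hr => hpos r (hsub hr)) (hinteg.mono_set hsub)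

lemma measurable_map (h : GapControlled Z F G M)
    (hcore : ∀ x ∉ Z, ∀ y ∉ Z, G x = 0 → G y = 0 → F x = F y) {φ : Y → ℝ} {K : ℝ}
    (hφ : ∀ x y, |φ x - φ y| ≤ K * dist x y) : Measurable fun x => φ (F x) := by
  have hφc : Continuous φ := by
    refine (LipschitzWith.of_dist_le_mul (K := ⟨max K 0, le_max_right _ _⟩) fun x y => ?_).continuous
    exact (hφ x y).trans (mul_le_mul_of_nonneg_right (le_max_left _ _) dist_nonneg)
  set s : Set (Euc m) := {x | 0 < G x}
  have hs : MeasurableSet s := measurableSet_lt measurable_const h.measurable_gap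
  refine measurable_of_restrict_of_restrict_compl hs ?_ ?_
  · exact (hφc.comp_continuousOn (h.continuousOn_map fun x hx => hx)).domRestrict.measurable
  · have hG0 : ∀ x : (sᶜ : Set (Euc m)), G x = 0 := fun x =>
      le_antisymm (not_lt.1 x.2) (h.nonneg x)
    have hnZ : ∀ x : (sᶜ : Set (Euc m)), (x : Euc m) ∉ Z := fun x hx => by
      have := h.eq_one _ hx
      rw [hG0 x] at this
      exact zero_ne_one this
    refine measurable_const' fun x y => ?_
    simp only [Set.domRestrict_apply]
    rw [hcore x (hnZ x) y (hnZ y) (hG0 x) (hG0 y)]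

lemma ae_pos (h : GapControlled Z F G M)
    (hfin : ∫⁻ x in Ω, (ENNReal.ofReal (G x))⁻¹ ≠ ⊤) :
    ∀ᵐ x ∂(volume.restrict Ω), 0 < G x := by
  filter_upwards [ae_lt_top h.measurable_gap.ennreal_ofReal.inv hfin] with x hx
  simpa using hx

lemma eLpNorm_gapGradient_le (h : GapControlled Z F G M) (hp : 1 ≤ p) :
    eLpNorm (gapGradient G M) (ENNReal.ofReal p) (volume.restrict Ω) ≤
      ENNReal.ofReal M * (volume Ω ^ (1 / p) +
        (∫⁻ x in Ω, (ENNReal.ofReal (G x))⁻¹ ^ p) ^ (1 / p)) := by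
  have hp0 : 0 < p := by linarith
  have hp1 : (1 : ENNReal) ≤ ENNReal.ofReal p := by simpa using hp
  have hpne : ENNReal.ofReal p ≠ 0 := by simpa using hp0
  have e1 : gapGradient G M = M • ((fun _ => (1 : ℝ)) + fun x => (G x)⁻¹) := by
    ext x; simp [gapGradient]
  have hM : ‖M‖ₑ = ENNReal.ofReal M := Real.enorm_eq_ofReal h.const_nonneg
  rw [e1, eLpNorm_const_smul, hM]
  gcongr
  refine (eLpNorm_add_le (by fun_prop) h.measurable_gap.inv.aestronglyMeasurable hp1).trans ?_
  refine add_le_add ?_ ?_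
  · rw [eLpNorm_const' _ hpne ENNReal.ofReal_ne_top, ENNReal.toReal_ofReal hp0.le]
    simp
  · rw [eLpNorm_eq_lintegral_rpow_enorm_toReal hpne ENNReal.ofReal_ne_top,
      ENNReal.toReal_ofReal hp0.le]
    gcongr with x
    exact enorm_inv_le_ofReal_inv (h.nonneg x)

lemma memLp_gapGradient (h : GapControlled Z F G M) (hp : 1 ≤ p) (hΩb : volume Ω ≠ ⊤)
    (hfin : ∫⁻ x in Ω, (ENNReal.ofReal (G x))⁻¹ ^ p ≠ ⊤) : MemLpOn m p Ω (gapGradient G M) := by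
  refine ⟨?_, (h.eLpNorm_gapGradient_le hp).trans_lt ?_⟩
  · exact (measurable_const.mul (measurable_const.add h.measurable_gap.inv)).aestronglyMeasurable
  · have : 0 ≤ 1 / p := by positivity
    refine ENNReal.mul_lt_top ENNReal.ofReal_lt_top (ENNReal.add_lt_top.2 ⟨?_, ?_⟩)
    · exact ENNReal.rpow_lt_top_of_nonneg this hΩb
    · exact ENNReal.rpow_lt_top_of_nonneg this hfin

theorem exists_weak_derivatives (h : GapControlled Z F G M) (hp : 1 ≤ p) (hΩo : IsOpen Ω)
    (hΩb : Bornology.IsBounded Ω) (hZ : Z.Nonempty) (hZΩ : Z ⊆ Ω)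
    (hcore : ∀ x ∉ Z, ∀ y ∉ Z, G x = 0 → G y = 0 → F x = F y)
    (hfin : ∫⁻ x in Ω, (ENNReal.ofReal (G x))⁻¹ ^ p ≠ ⊤) {K : ℝ} (hK : 0 ≤ K) {φ : Y → ℝ}
    (hφ : ∀ x y, |φ x - φ y| ≤ K * dist x y) :
    ∃ w : Fin m → Euc m → ℝ,
      MemW1pWith m p Ω (fun x => φ (F x)) w ∧
      (∀ k, ∀ᵐ x ∂(volume.restrict Ω), |w k x| ≤ K * gapGradient G M x) ∧
      (∀ k : Fin m, ∀ᵐ y : Euc m, ∀ a b : ℝ, a ≤ b →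
        (∀ t ∈ Set.Icc a b, y + t • EuclideanSpace.single k (1:ℝ) ∈ Ω) →
          ACOn (fun t => φ (F (y + t • EuclideanSpace.single k (1:ℝ)))) a b) ∧
      (∀ k : Fin m, ∀ᵐ x ∂(volume.restrict Ω),
        HasDerivAt (fun t : ℝ => φ (F (x + t • EuclideanSpace.single k (1:ℝ)))) (w k x) 0) := by
  have hvol : volume Ω ≠ ⊤ := hΩb.measure_lt_top.ne
  have : IsFiniteMeasure (volume.restrict Ω) := ⟨by simpa using hvol.lt_top⟩
  have hfin1 := lintegral_inv_gap_ne_top hp hvol hfin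
  set u : Euc m → ℝ := fun x => φ (F x)
  have hum : Measurable u := h.measurable_map hcore hφ
  set e : Fin m → Euc m := fun k => EuclideanSpace.single k (1 : ℝ)
  have he : ∀ k, ‖e k‖ = 1 := fun k => by simp [e]
  have hline := fun k => h.ae_line hΩo hfin1 (e k) (he k)
  have hAC : ∀ k, ∀ᵐ y : Euc m, ACAlong Ω u (e k) y := fun k => by
    filter_upwards [hline k] with y hy a b hab hseg
    exact AbsolutelyContinuousOnInterval.comp_lipschitz (φ := φ) hφ (hy a b hab hseg).2
  have humi : Measurable (Ω.indicator u) := hum.indicator hΩo.measurableSet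
  have hder := fun k => ae_hasDerivAt_of_ACAlong hΩo humi (hAC k)
  have hbound : ∀ k, ∀ᵐ x ∂(volume.restrict Ω), |dirDeriv u (e k) x| ≤ K * gapGradient G M x := by
    intro k
    filter_upwards [hder k, ae_restrict_of_ae (hline k), ae_restrict_mem hΩo.measurableSet]
      with x hx hl hxΩ
    obtain ⟨r, hr, hseg⟩ := exists_segment_subset (y := x) (t := 0) (e := e k) hΩo
      (by simpa using hxΩ)
    rw [zero_sub, zero_add] at hseg
    have hpos := (hl (-r) r (by linarith) hseg).1
    have hev := (h.comp_isometry (isometry_add_smul (he k) x)).eventually_dist_le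
      (s := Icc (-r) r) hpos (x := 0) ⟨by linarith, hr.le⟩
    rw [nhdsWithin_eq_nhds.2 (Icc_mem_nhds (by linarith) hr)] at hev
    have hC : 0 ≤ K * gapGradient G M x := mul_nonneg hK (h.gapGradient_nonneg x)
    have := hx.le_of_lip' hC (by
      filter_upwards [hev] with t ht
      simp only [Function.comp_apply, zero_smul, add_zero, dist_zero_right] at ht
      rw [Real.norm_eq_abs]
      calc |u (x + t • e k) - u (x + (0 : ℝ) • e k)|
          ≤ K * dist (F (x + t • e k)) (F (x + (0 : ℝ) • e k)) := hφ _ _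
        _ ≤ K * (gapGradient (G ∘ fun t : ℝ => x + t • e k) M 0 * ‖t‖) := by
          rw [zero_smul, add_zero]; gcongr
        _ = K * gapGradient G M x * ‖t - 0‖ := by
          simp [gapGradient, mul_assoc])
    simpa using this
  have hg := h.memLp_gapGradient hp hvol hfin
  have hw : ∀ k, MemLpOn m p Ω (dirDeriv u (e k)) := fun k =>
    (hg.const_mul K).mono (aemeasurable_dirDeriv hΩo humi (hAC k)).aestronglyMeasurable (by
      filter_upwards [hbound k] with x hx
      rw [Real.norm_eq_abs, Real.norm_eq_abs]
      exact hx.trans (le_abs_self _))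
  have hp1 : (1 : ENNReal) ≤ ENNReal.ofReal p := by simpa using hp
  obtain ⟨z, hz⟩ := hZ
  have hu : MemLpOn m p Ω u := by
    refine MemLp.of_bound hum.aestronglyMeasurable (|u z| + K * (M * diam Ω)) ?_
    filter_upwards [h.ae_pos hfin1, ae_restrict_mem hΩo.measurableSet] with x hx hxΩ
    have h1 := (hφ (F x) (F z)).trans (mul_le_mul_of_nonneg_left
      ((h.map_lip_core x hx z hz).trans (mul_le_mul_of_nonneg_left
        (dist_le_diam_of_mem hΩb hxΩ (hZΩ hz)) h.const_nonneg)) hK)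
    rw [Real.norm_eq_abs]
    calc |u x| = |u z + (u x - u z)| := by ring_nf
      _ ≤ |u z| + |u x - u z| := abs_add_le _ _
      _ ≤ _ := by gcongr
  refine ⟨fun k => dirDeriv u (e k), ⟨hu, fun k => ⟨hw k, fun ψ hψ hψc hψΩ => ?_⟩⟩, hbound,
    fun k => ?_, hder⟩
  · exact integral_mul_fderiv_of_ACAlong hΩo (hAC k) (hu.integrable hp1) ((hw k).integrable hp1)
      hψ hψc hψΩ
  · filter_upwards [hAC k] with y hy a b hab hseg
    rcases hab.eq_or_lt with rfl | hlt
    · refine ⟨0, by simp, fun x hx => ?_⟩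
      rw [Icc_self, mem_singleton_iff] at hx
      simp [hx]
    · exact .of_absolutelyContinuousOnInterval hab (hy a b hlt hseg)

end Global

end GapControlled

section Radial

variable {E : Type*} [NormedAddCommGroup E] [NormedSpace ℝ E] {N : E → ℝ} {L : ℝ}

lemma norm_inv_smul_sub_le (hL : ∀ x y, |N x - N y| ≤ L * ‖x - y‖)
    {κ : ℝ} (hκ : 0 < κ) (hN : ∀ x, ‖x‖ ≤ κ * N x) {x y : E} (hx : ‖x‖ = 1) (hy : ‖y‖ = 1) :
    ‖(N x)⁻¹ • x - (N y)⁻¹ • y‖ ≤ (κ + κ * κ * L) * ‖x - y‖ := by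
  have hNx : 0 < N x := by
    by_contra h; have := hN x; nlinarith [not_lt.1 h]
  have hNy : 0 < N y := by
    by_contra h; have := hN y; nlinarith [not_lt.1 h]
  have hix : (N x)⁻¹ ≤ κ := by
    rw [inv_le_iff_one_le_mul₀ hNx, ← hx]; exact hN x
  have hiy : (N y)⁻¹ ≤ κ := by
    rw [inv_le_iff_one_le_mul₀ hNy, ← hy]; exact hN y
  have e : (N x)⁻¹ • x - (N y)⁻¹ • y =
      (N x)⁻¹ • (x - y) + ((N x)⁻¹ * (N y)⁻¹ * (N y - N x)) • y := by
    have : (N x)⁻¹ * (N y)⁻¹ * (N y - N x) = (N x)⁻¹ - (N y)⁻¹ := by field_simp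
    rw [this]; module
  rw [e]
  refine (norm_add_le _ _).trans ?_
  rw [norm_smul, norm_smul, hy, norm_mul, norm_mul, norm_inv, norm_inv, Real.norm_of_nonneg hNx.le,
    Real.norm_of_nonneg hNy.le, Real.norm_eq_abs, abs_sub_comm, mul_one, add_mul]
  have := hL x y
  have h1 : (N x)⁻¹ * (N y)⁻¹ ≤ κ * κ := by gcongr
  have h2 : (N x)⁻¹ * (N y)⁻¹ * |N x - N y| ≤ κ * κ * (L * ‖x - y‖) := by gcongr
  have h3 : (N x)⁻¹ * ‖x - y‖ ≤ κ * ‖x - y‖ := by gcongr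
  linarith

lemma norm_div_norm_smul_sub_le (hN : ∀ x, 0 ≤ N x) (h0 : N 0 = 0)
    (hL : ∀ x y, |N x - N y| ≤ L * ‖x - y‖) (x y : E) :
    ‖(N x / ‖x‖) • x - (N y / ‖y‖) • y‖ ≤ 3 * L * ‖x - y‖ := by
  have hb : ∀ x, N x ≤ L * ‖x‖ := fun x => by
    have := hL x 0
    rw [h0, sub_zero, sub_zero, abs_of_nonneg (hN x)] at this
    exact this
  have hself : ∀ x : E, ‖(N x / ‖x‖) • x‖ ≤ 3 * L * ‖x‖ := fun x => by
    rcases eq_or_ne x 0 with rfl | hx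
    · simp
    · have := norm_pos_iff.2 hx
      rw [norm_smul, norm_div, norm_norm, Real.norm_of_nonneg (hN x), div_mul_cancel₀ _ this.ne']
      linarith [hb x, hN x]
  rcases eq_or_ne x 0 with rfl | hx
  · simpa using hself y
  rcases eq_or_ne y 0 with rfl | hy
  · simpa using hself x
  have hx0 := norm_pos_iff.2 hx
  have hy0 := norm_pos_iff.2 hy
  have e : (N x / ‖x‖) • x - (N y / ‖y‖) • y =
      (N x / ‖x‖) • (x - y) + (N x / ‖x‖ - N y / ‖y‖) • y := by module
  have hc : N x / ‖x‖ ≤ L := (div_le_iff₀ hx0).2 (hb x)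
  rw [e]
  refine (norm_add_le _ _).trans ?_
  rw [norm_smul, norm_smul, norm_div, norm_norm, Real.norm_of_nonneg (hN x), Real.norm_eq_abs]
  have h1 : |N x / ‖x‖ - N y / ‖y‖| * ‖y‖ ≤ N x / ‖x‖ * ‖x - y‖ + |N x - N y| := by
    have e2 : (N x / ‖x‖ - N y / ‖y‖) * ‖y‖ = N x / ‖x‖ * (‖y‖ - ‖x‖) + (N x - N y) := by
      field_simp; ring
    rw [← abs_of_nonneg hy0.le, ← abs_mul, abs_of_nonneg hy0.le, e2]
    refine (abs_add_le _ _).trans ?_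
    rw [abs_mul, abs_of_nonneg (div_nonneg (hN x) hx0.le)]
    have := abs_norm_sub_norm_le y x
    rw [norm_sub_rev y x] at this
    have h5 : 0 ≤ N x / ‖x‖ := div_nonneg (hN x) hx0.le
    gcongr
  have h2 : N x / ‖x‖ * ‖x - y‖ ≤ L * ‖x - y‖ := by gcongr
  linarith [hL x y]

end Radial

/-- The standard simplex spanned by a finite set of vertices. -/
def simplexOn {ι : Type*} (σ : Finset ι) : Set (ι → ℝ) :=
  {l | (∀ v, 0 ≤ l v) ∧ (∀ v, v ∉ σ → l v = 0) ∧ ∑ v ∈ σ, l v = 1}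

section SimplexBall

variable {d : ℕ}

/-- Sum-zero coordinates on `ℝ^d`. -/
def sumZero (x : Euc d) (o : Option (Fin d)) : ℝ := o.elim (-∑ i, x i) x

lemma sum_sumZero (x : Euc d) : ∑ o, sumZero x o = 0 := by
  simp [Fintype.sum_option, sumZero]

lemma sumZero_smul (t : ℝ) (x : Euc d) (o : Option (Fin d)) :
    sumZero (t • x) o = t * sumZero x o := by
  cases o <;> simp [sumZero, Finset.mul_sum]

lemma sumZero_sub (x y : Euc d) (o : Option (Fin d)) :
    sumZero (x - y) o = sumZero x o - sumZero y o := by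
  cases o <;> simp [sumZero]; ring

lemma abs_sumZero_le (x : Euc d) (o : Option (Fin d)) : |sumZero x o| ≤ d * ‖x‖ := by
  have h1 : ∑ i, |x i| ≤ d * ‖x‖ := by
    have := Finset.sum_le_card_nsmul Finset.univ (fun i => |x i|) ‖x‖
      (fun i _ => PiLp.norm_apply_le x i)
    simpa using this
  refine le_trans ?_ h1
  cases o with
  | none => simpa [sumZero] using Finset.abs_sum_le_sum_abs (fun i => x i) Finset.univ
  | some i =>
    exact Finset.single_le_sum (f := fun i => |x i|) (fun _ _ => abs_nonneg _)
      (Finset.mem_univ i)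

lemma norm_le_sum_abs (x : Euc d) : ‖x‖ ≤ ∑ i, |x i| := by
  rw [EuclideanSpace.norm_eq]
  refine Real.sqrt_le_iff.2 ⟨by positivity, ?_⟩
  exact Finset.sum_sq_le_sq_sum_of_nonneg (fun i _ => norm_nonneg _)

/-- The gauge of the simplex around its barycentre. -/
def simplexGauge (x : Euc d) : ℝ :=
  Finset.univ.sup' ⟨none, Finset.mem_univ _⟩ fun o => (d + 1) * -sumZero x o

lemma simplexGauge_le_iff {x : Euc d} {a : ℝ} :
    simplexGauge x ≤ a ↔ ∀ o, (d + 1) * -sumZero x o ≤ a :=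
  (Finset.sup'_le_iff _ _).trans ⟨fun h o => h o (Finset.mem_univ o), fun h o _ => h o⟩

lemma le_simplexGauge (x : Euc d) (o : Option (Fin d)) :
    (d + 1) * -sumZero x o ≤ simplexGauge x := simplexGauge_le_iff.1 le_rfl o

lemma exists_eq_simplexGauge (x : Euc d) : ∃ o, simplexGauge x = (d + 1) * -sumZero x o := by
  obtain ⟨o, -, h⟩ := Finset.exists_mem_eq_sup' ⟨none, Finset.mem_univ _⟩
    fun o : Option (Fin d) => ((d : ℝ) + 1) * -sumZero x o
  exact ⟨o, h⟩

lemma simplexGauge_smul {t : ℝ} (ht : 0 ≤ t) (x : Euc d) :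
    simplexGauge (t • x) = t * simplexGauge x := by
  refine le_antisymm (simplexGauge_le_iff.2 fun o => ?_) ?_
  · rw [sumZero_smul]
    have := mul_le_mul_of_nonneg_left (le_simplexGauge x o) ht
    linarith
  · obtain ⟨o, ho⟩ := exists_eq_simplexGauge x
    rw [ho]
    have := le_simplexGauge (t • x) o
    rw [sumZero_smul] at this
    linarith

lemma simplexGauge_sub_le (x y : Euc d) :
    simplexGauge x - simplexGauge y ≤ ((d + 1) * d : ℝ) * ‖x - y‖ := by
  rw [sub_le_iff_le_add, simplexGauge_le_iff]
  intro o
  have h1 := le_simplexGauge y o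
  have h2 := (abs_le.1 (abs_sumZero_le (x - y) o)).1
  rw [sumZero_sub] at h2
  nlinarith [(by positivity : (0 : ℝ) ≤ d + 1)]

lemma abs_simplexGauge_sub_le (x y : Euc d) :
    |simplexGauge x - simplexGauge y| ≤ ((d + 1) * d : ℝ) * ‖x - y‖ := by
  refine abs_sub_le_iff.2 ⟨simplexGauge_sub_le x y, ?_⟩
  rw [norm_sub_rev]
  exact simplexGauge_sub_le y x

lemma simplexGauge_nonneg (x : Euc d) : 0 ≤ simplexGauge x := by
  have h := Finset.sum_le_sum fun o (_ : o ∈ Finset.univ) => le_simplexGauge x o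
  rw [← Finset.mul_sum, Finset.sum_neg_distrib, sum_sumZero] at h
  simp at h
  exact nonneg_of_mul_nonneg_right h (by positivity)

lemma norm_le_simplexGauge (x : Euc d) : ‖x‖ ≤ 2 * simplexGauge x := by
  have hd : (0 : ℝ) < d + 1 := by positivity
  have h : ∀ o, |sumZero x o| ≤ 2 * simplexGauge x / (d + 1) + sumZero x o := by
    intro o
    have h1 := le_simplexGauge x o
    have h2 : -sumZero x o ≤ simplexGauge x / (d + 1) := by
      rw [le_div_iff₀ hd]; linarith
    have h3 : 0 ≤ simplexGauge x / (d + 1) := div_nonneg (simplexGauge_nonneg x) hd.le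
    rw [mul_div_assoc, abs_le]
    constructor <;> linarith
  have h2 := Finset.sum_le_sum fun o (_ : o ∈ Finset.univ) => h o
  rw [Finset.sum_add_distrib, sum_sumZero, Fintype.sum_option] at h2
  simp only [Finset.sum_const, Finset.card_univ, Fintype.card_option, Fintype.card_fin,
    nsmul_eq_mul, add_zero] at h2
  push_cast at h2
  rw [mul_div_cancel₀ _ hd.ne'] at h2
  have h3 := norm_le_sum_abs x
  have h4 : ∑ i, |sumZero x (some i)| = ∑ i, |x i| := rfl
  linarith [abs_nonneg (sumZero x none)]

/-- The point of the sum-one hyperplane with sum-zero coordinates `x` around the barycentre. -/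
def baryPoint (x : Euc d) (o : Option (Fin d)) : ℝ := (d + 1 : ℝ)⁻¹ + sumZero x o

/-- The inverse of `baryPoint`. -/
def baryCoord (l : Option (Fin d) → ℝ) : Euc d :=
  WithLp.toLp 2 fun i => l (some i) - (d + 1 : ℝ)⁻¹

lemma sum_baryPoint (x : Euc d) : ∑ o, baryPoint x o = 1 := by
  have hd : (d : ℝ) + 1 ≠ 0 := by positivity
  simp only [baryPoint, Finset.sum_add_distrib, sum_sumZero]
  simp [hd]

lemma baryPoint_baryCoord {l : Option (Fin d) → ℝ} (hl : ∑ o, l o = 1) :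
    baryPoint (baryCoord l) = l := by
  have hd : (d : ℝ) + 1 ≠ 0 := by positivity
  ext o
  cases o with
  | some i => simp [baryPoint, baryCoord, sumZero]
  | none =>
    rw [Fintype.sum_option] at hl
    simp [baryPoint, baryCoord, sumZero]
    field_simp
    linear_combination (-(d : ℝ) - 1) * hl

lemma baryPoint_nonneg_iff {x : Euc d} : (∀ o, 0 ≤ baryPoint x o) ↔ simplexGauge x ≤ 1 := by
  have hd : (0 : ℝ) < d + 1 := by positivity
  rw [simplexGauge_le_iff]
  refine forall_congr' fun o => ?_
  rw [baryPoint, mul_comm, ← le_div_iff₀ hd, one_div]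
  constructor <;> intro h <;> linarith

lemma exists_baryPoint_eq_zero {x : Euc d} (hx : simplexGauge x = 1) : ∃ o, baryPoint x o = 0 := by
  have hd : (d : ℝ) + 1 ≠ 0 := by positivity
  obtain ⟨o, ho⟩ := exists_eq_simplexGauge x
  refine ⟨o, ?_⟩
  rw [hx] at ho
  rw [baryPoint]
  field_simp
  linarith

lemma one_le_simplexGauge {x : Euc d} {o : Option (Fin d)} (hx : baryPoint x o = 0) :
    1 ≤ simplexGauge x := by
  have hd : (d : ℝ) + 1 ≠ 0 := by positivity
  refine le_trans (le_of_eq ?_) (le_simplexGauge x o)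
  rw [baryPoint] at hx
  field_simp at hx
  linarith

/-- The simplex of dimension `d` is bilipschitz to the unit ball of `ℝ^d`. -/
lemma exists_simplex_ball (d : ℕ) : ∃ C : ℝ, 0 ≤ C ∧
    ∃ (P : Euc d → Option (Fin d) → ℝ) (A : (Option (Fin d) → ℝ) → Euc d),
      (∀ x ∈ sphere (0 : Euc d) 1, P x ∈ simplexOn Finset.univ ∧ ∃ o, P x o = 0) ∧
      (∀ x ∈ sphere (0 : Euc d) 1, ∀ y ∈ sphere (0 : Euc d) 1,
        ∑ o, |P x o - P y o| ≤ C * dist x y) ∧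
      (∀ l ∈ simplexOn Finset.univ, A l ∈ closedBall (0 : Euc d) 1) ∧
      (∀ l m, dist (A l) (A m) ≤ C * ∑ o, |l o - m o|) ∧
      (∀ l ∈ simplexOn Finset.univ, (∃ o, l o = 0) →
        A l ∈ sphere (0 : Euc d) 1 ∧ P (A l) = l) := by
  set L : ℝ := (d + 1) * d
  have hL0 : 0 ≤ L := by positivity
  set C1 : ℝ := (d + 1) * (d * (2 + 2 * 2 * L))
  have hpos : ∀ x ∈ sphere (0 : Euc d) 1, 0 < simplexGauge x := fun x hx => by
    have := norm_le_simplexGauge x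
    rw [mem_sphere_zero_iff_norm.1 hx] at this
    linarith
  have h0 : simplexGauge (0 : Euc d) = 0 := by
    simpa using simplexGauge_smul (le_refl (0 : ℝ)) (0 : Euc d)
  have hAnorm : ∀ x : Euc d, ‖(simplexGauge x / ‖x‖) • x‖ = simplexGauge x := fun x => by
    rcases eq_or_ne x 0 with rfl | hx
    · simp [h0]
    · rw [norm_smul, norm_div, norm_norm, Real.norm_of_nonneg (simplexGauge_nonneg x),
        div_mul_cancel₀ _ (norm_ne_zero_iff.2 hx)]
  refine ⟨max C1 (3 * L), le_max_of_le_right (by positivity),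
    fun x => baryPoint ((simplexGauge x)⁻¹ • x),
    fun l => (simplexGauge (baryCoord l) / ‖baryCoord l‖) • baryCoord l, ?_, ?_, ?_, ?_, ?_⟩
  · intro x hx
    have h1 : simplexGauge ((simplexGauge x)⁻¹ • x) = 1 := by
      rw [simplexGauge_smul (inv_nonneg.2 (hpos x hx).le), inv_mul_cancel₀ (hpos x hx).ne']
    exact ⟨⟨baryPoint_nonneg_iff.2 h1.le, fun v hv => absurd (Finset.mem_univ v) hv,
      sum_baryPoint _⟩, exists_baryPoint_eq_zero h1⟩
  · intro x hx y hy
    have h1 := norm_inv_smul_sub_le (N := simplexGauge) abs_simplexGauge_sub_le two_pos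
      norm_le_simplexGauge (mem_sphere_zero_iff_norm.1 hx) (mem_sphere_zero_iff_norm.1 hy)
    have h2 : ∀ o, |baryPoint ((simplexGauge x)⁻¹ • x) o - baryPoint ((simplexGauge y)⁻¹ • y) o| ≤
        d * ((2 + 2 * 2 * L) * ‖x - y‖) := fun o => by
      rw [baryPoint, baryPoint, add_sub_add_left_eq_sub, ← sumZero_sub]
      exact (abs_sumZero_le _ o).trans (by gcongr)
    have h3 := Finset.sum_le_card_nsmul Finset.univ _ _ fun o _ => h2 o
    simp only [Finset.card_univ, Fintype.card_option, Fintype.card_fin, nsmul_eq_mul] at h3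
    push_cast at h3
    rw [dist_eq_norm]
    calc _ ≤ C1 * ‖x - y‖ := by simp only [C1]; linarith
      _ ≤ _ := by gcongr; exact le_max_left _ _
  · intro l hl
    rw [mem_closedBall_zero_iff, hAnorm, ← baryPoint_nonneg_iff, baryPoint_baryCoord hl.2.2]
    exact hl.1
  · intro l m
    rw [dist_eq_norm]
    refine (norm_div_norm_smul_sub_le simplexGauge_nonneg h0 abs_simplexGauge_sub_le _ _).trans ?_
    refine mul_le_mul (le_max_right _ _) ?_ (norm_nonneg _) (le_max_of_le_right (by positivity))
    refine (norm_le_sum_abs _).trans ?_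
    rw [Fintype.sum_option]
    refine le_add_of_nonneg_of_le (abs_nonneg _) (le_of_eq ?_)
    simp [baryCoord]
  · rintro l hl ⟨o, ho⟩
    have hb := baryPoint_baryCoord hl.2.2
    have h1 : simplexGauge (baryCoord l) = 1 := by
      refine le_antisymm (baryPoint_nonneg_iff.1 (by rw [hb]; exact hl.1))
        (one_le_simplexGauge (o := o) (by rw [hb]; exact ho))
    refine ⟨by rw [mem_sphere_zero_iff_norm, hAnorm, h1], ?_⟩
    have hne : baryCoord l ≠ 0 := fun h => by rw [h, h0] at h1; exact zero_ne_one h1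
    have hn := norm_pos_iff.2 hne
    simp only [h1, one_div]
    rw [simplexGauge_smul (inv_nonneg.2 hn.le), h1, smul_smul, mul_one, inv_inv,
      mul_inv_cancel₀ hn.ne', one_smul, hb]

end SimplexBall

section Extension

variable {ι : Type*}

lemma nonempty_of_mem_simplexOn {σ : Finset ι} {l : ι → ℝ} (hl : l ∈ simplexOn σ) : σ.Nonempty := by
  rw [Finset.nonempty_iff_ne_empty]
  rintro rfl
  simpa using hl.2.2

lemma mem_simplexOn_of_subset {σ τ : Finset ι} {l : ι → ℝ} (hl : l ∈ simplexOn σ) (hτ : τ ⊆ σ)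
    (h0 : ∀ v ∈ σ, v ∉ τ → l v = 0) : l ∈ simplexOn τ := by
  classical
  refine ⟨hl.1, fun v hv => ?_, ?_⟩
  · by_cases h : v ∈ σ
    · exact h0 v h hv
    · exact hl.2.1 v h
  · rw [Finset.sum_subset hτ h0]; exact hl.2.2

/-- Extension of a Lipschitz map from the boundary of a simplex to the simplex. -/
lemma exists_extend_simplex (k : ℕ) : ∃ C : ℝ, 0 ≤ C ∧
    ∀ (n : ℕ) (c : ℝ) (Y : Type) [MetricSpace Y], 0 ≤ c → k < n → LipschitzConnected n c Y →
    ∀ {ι : Type} (σ : Finset ι), σ.card = k + 2 → ∀ (E : (ι → ℝ) → Y) (K : ℝ), 0 ≤ K →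
    (∀ l ∈ simplexOn σ, ∀ m ∈ simplexOn σ, (∃ v ∈ σ, l v = 0) → (∃ v ∈ σ, m v = 0) →
      dist (E l) (E m) ≤ K * ∑ v ∈ σ, |l v - m v|) →
    ∃ G : (ι → ℝ) → Y, (∀ l ∈ simplexOn σ, (∃ v ∈ σ, l v = 0) → G l = E l) ∧
      ∀ l ∈ simplexOn σ, ∀ m ∈ simplexOn σ,
        dist (G l) (G m) ≤ c * (K * C) * (C * ∑ v ∈ σ, |l v - m v|) := by
  classical
  obtain ⟨C, hC, P, A, hP1, hP2, hA1, hA2, hPA⟩ := exists_simplex_ball (k + 1)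
  refine ⟨C, hC, fun n c Y _ hc hk hY ι σ hσ E K hK hE => ?_⟩
  have hcard : Fintype.card (Option (Fin (k + 1))) = Fintype.card σ := by simp [hσ]
  set e : Option (Fin (k + 1)) ≃ σ := Fintype.equivOfCardEq hcard
  have hsum : ∀ f : ι → ℝ, ∑ v ∈ σ, f v = ∑ o, f (e o) := fun f => by
    rw [← Finset.sum_coe_sort, ← e.sum_comp]
  set lift : (Option (Fin (k + 1)) → ℝ) → ι → ℝ :=
    fun m v => if h : v ∈ σ then m (e.symm ⟨v, h⟩) else 0
  have hlift : ∀ m o, lift m (e o) = m o := fun m o => by simp [lift]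
  set pull : (ι → ℝ) → Option (Fin (k + 1)) → ℝ := fun l o => l (e o)
  have hlp : ∀ l ∈ simplexOn σ, lift (pull l) = l := fun l hl => by
    ext v
    by_cases h : v ∈ σ
    · simp [lift, pull, h]
    · simp [lift, h, hl.2.1 v h]
  have hpm : ∀ l ∈ simplexOn σ, pull l ∈ simplexOn Finset.univ := fun l hl =>
    ⟨fun o => hl.1 _, fun o ho => absurd (Finset.mem_univ o) ho, by rw [← hsum]; exact hl.2.2⟩
  have hlm : ∀ m ∈ simplexOn Finset.univ, lift m ∈ simplexOn σ := fun m hm => by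
    refine ⟨fun v => ?_, fun v hv => by simp [lift, hv], ?_⟩
    · by_cases h : v ∈ σ
      · simp only [lift, h, dif_pos]; exact hm.1 _
      · simp [lift, h]
    · rw [hsum]; simp_rw [hlift]; exact hm.2.2
  obtain ⟨F, hF1, hF2⟩ := hY k hk (K * C) (mul_nonneg hK hC) (fun x => E (lift (P x)))
    fun x hx y hy => by
      obtain ⟨hx1, ox, hx2⟩ := hP1 x hx
      obtain ⟨hy1, oy, hy2⟩ := hP1 y hy
      refine (hE _ (hlm _ hx1) _ (hlm _ hy1) ⟨e ox, (e ox).2, by rw [hlift, hx2]⟩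
        ⟨e oy, (e oy).2, by rw [hlift, hy2]⟩).trans ?_
      rw [hsum, mul_assoc]
      simp_rw [hlift]
      exact mul_le_mul_of_nonneg_left (hP2 x hx y hy) hK
  refine ⟨fun l => F (A (pull l)), fun l hl ⟨v, hv, hv0⟩ => ?_, fun l hl m hm => ?_⟩
  · obtain ⟨h1, h2⟩ := hPA (pull l) (hpm l hl) ⟨e.symm ⟨v, hv⟩, by simpa [pull] using hv0⟩
    simp only
    rw [hF2 _ h1, h2, hlp l hl]
  · have h1 := hF1 _ (hA1 _ (hpm l hl)) _ (hA1 _ (hpm m hm))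
    have h2 := hA2 (pull l) (pull m)
    rw [hsum]
    exact h1.trans (mul_le_mul_of_nonneg_left h2 (by positivity))

/-- Moving between facets: a map that is Lipschitz on small faces is Lipschitz on the boundary of
a simplex. -/
lemma dist_le_of_mem_boundary {Y : Type*} [PseudoMetricSpace Y] {k : ℕ} {σ : Finset ι}
    (hσ : σ.card = k + 2) {E : (ι → ℝ) → Y} {C : ℝ} {D : ℝ}
    (hE : ∀ τ ⊆ σ, τ.card ≤ k + 1 → ∀ l ∈ simplexOn τ, ∀ m ∈ simplexOn τ,
      dist (E l) (E m) ≤ C * D * ∑ v ∈ τ, |l v - m v|) (hC : 1 ≤ C) (hD : 0 ≤ D)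
    (hvert : ∀ v ∈ σ, ∀ w ∈ σ, ∀ l ∈ simplexOn {v}, ∀ m ∈ simplexOn {w}, dist (E l) (E m) ≤ D)
    {l m : ι → ℝ} (hl : l ∈ simplexOn σ) (hm : m ∈ simplexOn σ)
    (hl0 : ∃ v ∈ σ, l v = 0) (hm0 : ∃ v ∈ σ, m v = 0) :
    dist (E l) (E m) ≤ 5 * C * D * ∑ v ∈ σ, |l v - m v| := by
  classical
  obtain ⟨i, hi, hli⟩ := hl0
  obtain ⟨j, hj, hmj⟩ := hm0
  set S := ∑ v ∈ σ, |l v - m v|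
  have hS0 : 0 ≤ S := Finset.sum_nonneg fun _ _ => abs_nonneg _
  have hCD : 0 ≤ C * D := mul_nonneg (by linarith) hD
  -- the facet opposite to a vertex
  have hfacet : ∀ {q : ι → ℝ} {v : ι}, q ∈ simplexOn σ → v ∈ σ → q v = 0 →
      q ∈ simplexOn (σ.erase v) := fun {q v} hq hv h0 =>
    mem_simplexOn_of_subset hq (Finset.erase_subset _ _) fun w hw hw' => by
      have : w = v := by by_contra h; exact hw' (Finset.mem_erase.2 ⟨h, hw⟩)
      rw [this, h0]
  have hstep : ∀ {q r : ι → ℝ} {v : ι}, q ∈ simplexOn σ → r ∈ simplexOn σ → v ∈ σ → q v = 0 →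
      r v = 0 → dist (E q) (E r) ≤ C * D * ∑ v ∈ σ, |q v - r v| := by
    intro q r v hq hr hv hqv hrv
    refine (hE (σ.erase v) (Finset.erase_subset _ _) (by rw [Finset.card_erase_of_mem hv]; omega) q
      (hfacet hq hv hqv) r (hfacet hr hv hrv)).trans (mul_le_mul_of_nonneg_left ?_ hCD)
    exact Finset.sum_le_sum_of_subset_of_nonneg (Finset.erase_subset _ _) fun _ _ _ => abs_nonneg _
  by_cases hmi : m i = 0
  · refine (hstep hl hm hi hli hmi).trans ?_
    nlinarith [mul_nonneg hCD hS0]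
  have hij : i ≠ j := fun h => hmi (h ▸ hmj)
  by_cases hex : ∃ r ∈ σ, r ≠ i ∧ r ≠ j
  · obtain ⟨r, hr, hri, hrj⟩ := hex
    set q : ι → ℝ := fun v => if v = j then 0 else if v = r then l r + l j else l v
    have hqsum : ∀ f : ι → ℝ → ℝ, ∑ v ∈ σ, f v (q v) =
        (∑ v ∈ σ, f v (l v)) + (f j 0 - f j (l j)) + (f r (l r + l j) - f r (l r)) := by
      intro f
      have e : ∀ v ∈ σ, f v (q v) = f v (l v) + ((if v = j then f j 0 - f j (l j) else 0) +
          (if v = r then f r (l r + l j) - f r (l r) else 0)) := by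
        intro v _
        simp only [q]
        by_cases h1 : v = j
        · subst h1; simp [hrj.symm]
        · by_cases h2 : v = r
          · subst h2; simp [h1]
          · simp [h1, h2]
      rw [Finset.sum_congr rfl e, Finset.sum_add_distrib, Finset.sum_add_distrib,
        Finset.sum_ite_eq' σ j, Finset.sum_ite_eq' σ r, if_pos hj, if_pos hr, add_assoc]
    have hq : q ∈ simplexOn σ := by
      refine ⟨fun v => ?_, fun v hv => ?_, ?_⟩
      · simp only [q]; split_ifs
        · exact le_rfl
        · exact add_nonneg (hl.1 _) (hl.1 _)
        · exact hl.1 _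
      · have h1 : v ≠ j := fun h => hv (h ▸ hj)
        have h2 : v ≠ r := fun h => hv (h ▸ hr)
        simp [q, h1, h2, hl.2.1 v hv]
      · rw [hqsum fun _ x => x, hl.2.2]; ring
    have hlj : l j ≤ S := by
      have := Finset.single_le_sum (f := fun v => |l v - m v|) (fun _ _ => abs_nonneg _) hj
      simp only [hmj, sub_zero] at this
      exact (le_abs_self _).trans this
    have hd1 : ∑ v ∈ σ, |l v - q v| ≤ 2 * S := by
      rw [hqsum fun v x => |l v - x|]
      simp [abs_of_nonneg (hl.1 j)]
      linarith
    have hd2 : ∑ v ∈ σ, |q v - m v| ≤ 3 * S := by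
      calc ∑ v ∈ σ, |q v - m v| ≤ ∑ v ∈ σ, (|l v - q v| + |l v - m v|) :=
            Finset.sum_le_sum fun v _ => by
              rw [abs_sub_comm (l v) (q v)]
              exact abs_sub_le _ _ _
        _ ≤ _ := by rw [Finset.sum_add_distrib]; linarith
    have hqi : q i = 0 := by simp [q, hij, hri.symm, hli]
    have h1 := hstep hl hq hi hli hqi
    have h2 := hstep hq hm hj (by simp [q]) hmj
    have h3 := mul_le_mul_of_nonneg_left hd1 hCD
    have h4 := mul_le_mul_of_nonneg_left hd2 hCD
    linarith [dist_triangle (E l) (E q) (E m)]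
  · push Not at hex
    have hl1 : l ∈ simplexOn {j} := mem_simplexOn_of_subset hl (by simpa using hj) fun v hv hv' => by
      by_cases h : v = i
      · rw [h, hli]
      · exact absurd (hex v hv h) (by simpa using hv')
    have hm1 : m ∈ simplexOn {i} := mem_simplexOn_of_subset hm (by simpa using hi) fun v hv hv' => by
      have : v ≠ i := by simpa using hv'
      rw [hex v hv this, hmj]
    have hS1 : 1 ≤ S := by
      have := Finset.single_le_sum (f := fun v => |l v - m v|) (fun _ _ => abs_nonneg _) hj
      have h1 : l j = 1 := by simpa using hl1.2.2
      simp only [hmj, h1, sub_zero, abs_one] at this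
      exact this
    refine (hvert j hj i hi l hl1 m hm1).trans ?_
    nlinarith [mul_nonneg hCD hS0, mul_nonneg hD hS0, mul_nonneg (mul_nonneg hD hS0) (sub_nonneg.2 hC)]

/-- A Lipschitz `(n-1)`-connected space admits barycentric fillings of finite subsets of
cardinality at most `n + 1`. -/
theorem exists_barycentric_filling (n : ℕ) {c : ℝ} (hc : 1 ≤ c) (k : ℕ) (hk : k ≤ n) :
    ∃ C : ℝ, 1 ≤ C ∧ ∀ (Y : Type) [MetricSpace Y], LipschitzConnected n c Y →
      ∀ {ι : Type} [Nonempty ι] (y : ι → Y), ∃ E : (ι → ℝ) → Y,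
        (∀ v, ∀ l ∈ simplexOn {v}, E l = y v) ∧
        ∀ σ : Finset ι, σ.card ≤ k + 1 → ∀ D : ℝ, (∀ v ∈ σ, ∀ w ∈ σ, dist (y v) (y w) ≤ D) →
          ∀ l ∈ simplexOn σ, ∀ m ∈ simplexOn σ,
            dist (E l) (E m) ≤ C * D * ∑ v ∈ σ, |l v - m v| := by
  classical
  have hsingle : ∀ {ι : Type} {v w : ι} {l : ι → ℝ}, l ∈ simplexOn {v} → l ∈ simplexOn {w} →
      v = w := by
    intro ι v w l hv hw
    by_contra h
    have h1 : l v = 1 := by simpa using hv.2.2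
    rw [hw.2.1 v (by simpa using h)] at h1
    exact zero_ne_one h1
  induction k with
  | zero =>
    refine ⟨1, le_rfl, fun Y _ _ ι _ y => ?_⟩
    set E : (ι → ℝ) → Y := fun l =>
      if h : ∃ v, l ∈ simplexOn {v} then y h.choose else y (Classical.arbitrary ι)
    have hE : ∀ v, ∀ l ∈ simplexOn {v}, E l = y v := fun v l hl => by
      have h : ∃ v, l ∈ simplexOn {v} := ⟨v, hl⟩
      simp only [E, dif_pos h]
      rw [hsingle h.choose_spec hl]
    refine ⟨E, hE, fun σ hσ D hD l hl m hm => ?_⟩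
    obtain ⟨v, rfl⟩ := Finset.card_eq_one.1
      (le_antisymm hσ (Finset.card_pos.2 (nonempty_of_mem_simplexOn hl)))
    rw [hE v l hl, hE v m hm, dist_self]
    have := (dist_nonneg).trans (hD v (by simp) v (by simp))
    positivity
  | succ k ih =>
    obtain ⟨C, hC1, hC⟩ := ih (by omega)
    obtain ⟨B, hB0, hB⟩ := exists_extend_simplex k
    refine ⟨max C (c * (5 * C * B) * B), le_max_of_le_left hC1, fun Y _ hY ι _ y => ?_⟩
    obtain ⟨E, hE1, hE2⟩ := hC Y hY y
    have hG : ∀ σ : Finset ι, ∃ G : (ι → ℝ) → Y, σ.card = k + 2 →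
        (∀ l ∈ simplexOn σ, (∃ v ∈ σ, l v = 0) → G l = E l) ∧
        ∀ D : ℝ, (∀ v ∈ σ, ∀ w ∈ σ, dist (y v) (y w) ≤ D) → ∀ l ∈ simplexOn σ, ∀ m ∈ simplexOn σ,
          dist (G l) (G m) ≤ c * (5 * C * B) * B * D * ∑ v ∈ σ, |l v - m v| := by
      intro σ
      by_cases hσ : σ.card = k + 2
      swap
      · exact ⟨E, fun h => absurd h hσ⟩
      set D0 := diam (y '' (σ : Set ι))
      have hD0 : 0 ≤ D0 := diam_nonneg
      have hbd : Bornology.IsBounded (y '' (σ : Set ι)) := (σ.finite_toSet.image y).isBounded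
      have hdist : ∀ v ∈ σ, ∀ w ∈ σ, dist (y v) (y w) ≤ D0 := fun v hv w hw =>
        dist_le_diam_of_mem hbd (mem_image_of_mem y hv) (mem_image_of_mem y hw)
      obtain ⟨G, hG1, hG2⟩ := hB n c Y (by linarith) (by omega) hY σ hσ E (5 * C * D0)
        (by positivity) fun l hl m hm hl0 hm0 =>
          dist_le_of_mem_boundary hσ (fun τ hτ hτc => hE2 τ hτc D0
            fun v hv w hw => hdist v (hτ hv) w (hτ hw)) hC1 hD0
            (fun v hv w hw l hl m hm => by rw [hE1 v l hl, hE1 w m hm]; exact hdist v hv w hw)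
            hl hm hl0 hm0
      refine ⟨G, fun _ => ⟨hG1, fun D hD l hl m hm => (hG2 l hl m hm).trans ?_⟩⟩
      have hDD : D0 ≤ D := by
        obtain ⟨v, hv⟩ := nonempty_of_mem_simplexOn hl
        refine diam_le_of_forall_dist_le (dist_nonneg.trans (hD v hv v hv)) ?_
        rintro _ ⟨v, hv, rfl⟩ _ ⟨w, hw, rfl⟩
        exact hD v hv w hw
      have hS0 : 0 ≤ ∑ v ∈ σ, |l v - m v| := Finset.sum_nonneg fun _ _ => abs_nonneg _
      calc c * (5 * C * D0 * B) * (B * ∑ v ∈ σ, |l v - m v|)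
          = c * (5 * C * B) * B * D0 * ∑ v ∈ σ, |l v - m v| := by ring
        _ ≤ _ := by gcongr
    choose G hG using hG
    set E' : (ι → ℝ) → Y := fun l =>
      if h : ∃ σ : Finset ι, σ.card = k + 2 ∧ l ∈ simplexOn σ ∧ ∀ v ∈ σ, l v ≠ 0 then
        G h.choose l else E l
    have hsub : ∀ {σ τ : Finset ι} {l : ι → ℝ}, l ∈ simplexOn σ → (∀ v ∈ τ, l v ≠ 0) → τ ⊆ σ :=
      fun {σ τ l} hl hτ v hv => by by_contra h; exact hτ v hv (hl.2.1 v h)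
    have hE'small : ∀ σ : Finset ι, σ.card ≤ k + 1 → ∀ l ∈ simplexOn σ, E' l = E l := by
      intro σ hσ l hl
      refine dif_neg ?_
      rintro ⟨τ, hτ, -, h0⟩
      have := Finset.card_le_card (hsub hl h0)
      omega
    have hE'big : ∀ σ : Finset ι, σ.card = k + 2 → ∀ l ∈ simplexOn σ, E' l = G σ l := by
      intro σ hσ l hl
      by_cases h : ∃ σ : Finset ι, σ.card = k + 2 ∧ l ∈ simplexOn σ ∧ ∀ v ∈ σ, l v ≠ 0
      · have h1 := h.choose_spec
        have h2 : h.choose = σ := Finset.eq_of_subset_of_card_le (hsub hl h1.2.2) (by omega)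
        simp only [E', dif_pos h]
        rw [h2]
      · simp only [E', dif_neg h]
        refine ((hG σ hσ).1 l hl ?_).symm
        by_contra h0
        push Not at h0
        exact h ⟨σ, hσ, hl, h0⟩
    refine ⟨E', fun v l hl => ?_, fun σ hσ D hD l hl m hm => ?_⟩
    · rw [hE'small {v} (by simp) l hl, hE1 v l hl]
    · have hD0 : 0 ≤ D := by
        obtain ⟨v, hv⟩ := nonempty_of_mem_simplexOn hl
        exact dist_nonneg.trans (hD v hv v hv)
      have hS0 : 0 ≤ ∑ v ∈ σ, |l v - m v| := Finset.sum_nonneg fun _ _ => abs_nonneg _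
      rcases hσ.lt_or_eq with hlt | heq
      · rw [hE'small σ (by omega) l hl, hE'small σ (by omega) m hm]
        refine (hE2 σ (by omega) D hD l hl m hm).trans ?_
        gcongr
        exact le_max_left _ _
      · rw [hE'big σ heq l hl, hE'big σ heq m hm]
        refine ((hG σ heq).2 D hD l hl m hm).trans ?_
        gcongr
        exact le_max_right _ _

end Extension

section TopWeights

variable {V : Type*} {N : ℕ} {a a' : V → ℝ} {η : ℝ}

/-- The set of levels above which `a` takes at most `N` values. -/
def levelSet (N : ℕ) (a : V → ℝ) : Set ℝ :=
  {r | 0 ≤ r ∧ ∀ T : Finset V, (∀ w ∈ T, r < a w) → T.card ≤ N}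

/-- The `(N+1)`-st largest value of `a` (or zero). -/
def threshold (N : ℕ) (a : V → ℝ) : ℝ := sInf (levelSet N a)

/-- The excess of `a` over its `(N+1)`-st largest value. -/
def topPart (N : ℕ) (a : V → ℝ) (v : V) : ℝ := max 0 (a v - threshold N a)

/-- The total excess. -/
def topMass (N : ℕ) (a : V → ℝ) : ℝ := ∑ᶠ v, topPart N a v

/-- The normalised excess. -/
def topWeight (N : ℕ) (a : V → ℝ) (v : V) : ℝ := topPart N a v / topMass N a

lemma threshold_nonneg : 0 ≤ threshold N a := Real.sInf_nonneg fun _ h => h.1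

lemma bddBelow_levelSet : BddBelow (levelSet N a) := ⟨0, fun _ h => h.1⟩

lemma levelSet_nonempty (ha : (Function.support a).Finite) : (levelSet N a).Nonempty := by
  refine ⟨∑ v ∈ ha.toFinset, |a v|, Finset.sum_nonneg fun _ _ => abs_nonneg _, fun T hT => ?_⟩
  suffices hT0 : T = ∅ by simp [hT0]
  refine Finset.eq_empty_of_forall_notMem fun w hw => ?_
  have h := hT w hw
  have h0 : 0 < a w := (Finset.sum_nonneg fun _ _ => abs_nonneg _).trans_lt h
  have h1 := Finset.single_le_sum (f := fun v => |a v|) (fun _ _ => abs_nonneg _)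
    (ha.mem_toFinset.2 (Function.mem_support.2 h0.ne'))
  exact absurd ((le_abs_self _).trans h1) (not_le.2 h)

lemma threshold_mem (ha : (Function.support a).Finite) : threshold N a ∈ levelSet N a := by
  refine ⟨threshold_nonneg, fun T hT => ?_⟩
  rcases T.eq_empty_or_nonempty with rfl | hne
  · simp
  obtain ⟨v, hv, hmin⟩ := Finset.exists_min_image T a hne
  obtain ⟨r, hr, hrv⟩ := exists_lt_of_csInf_lt (levelSet_nonempty ha) (hT v hv)
  exact hr.2 T fun w hw => hrv.trans_le (hmin w hw)

lemma threshold_le_add (ha : (Function.support a).Finite) (h : ∀ v, |a' v - a v| ≤ η) (hη : 0 ≤ η) :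
    threshold N a' ≤ threshold N a + η := by
  refine csInf_le bddBelow_levelSet ⟨add_nonneg threshold_nonneg hη, fun T hT => ?_⟩
  exact (threshold_mem ha).2 T fun w hw => by linarith [hT w hw, (abs_le.1 (h w)).2]

lemma abs_threshold_sub_le (ha : (Function.support a).Finite) (ha' : (Function.support a').Finite)
    (h : ∀ v, |a' v - a v| ≤ η) (hη : 0 ≤ η) : |threshold N a' - threshold N a| ≤ η := by
  refine abs_sub_le_iff.2 ⟨?_, ?_⟩
  · linarith [threshold_le_add (N := N) ha h hη]
  · have := threshold_le_add (N := N) ha' (fun v => (abs_sub_comm (a v) (a' v)).trans_le (h v)) hη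
    linarith

lemma topPart_nonneg (v : V) : 0 ≤ topPart N a v := le_max_left _ _

lemma abs_topPart_sub_le (ha : (Function.support a).Finite) (ha' : (Function.support a').Finite)
    (h : ∀ v, |a' v - a v| ≤ η) (hη : 0 ≤ η) (v : V) :
    |topPart N a' v - topPart N a v| ≤ 2 * η := by
  have h1 := abs_le.1 (abs_threshold_sub_le (N := N) ha ha' h hη)
  have h2 := abs_le.1 (h v)
  have h3 := abs_max_sub_max_le_abs (a' v - threshold N a') (a v - threshold N a) 0
  rw [max_comm _ 0, max_comm _ 0] at h3
  refine h3.trans (abs_le.2 ⟨?_, ?_⟩) <;> linarith [h1.1, h1.2]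

lemma topPart_pos_iff {v : V} : 0 < topPart N a v ↔ threshold N a < a v := by
  simp [topPart]

lemma support_topPart_finite (ha : (Function.support a).Finite) :
    (Function.support (topPart N a)).Finite := by
  refine ha.subset fun v hv => ?_
  have := topPart_pos_iff.1 ((topPart_nonneg v).lt_of_ne' hv)
  exact (threshold_nonneg.trans_lt this).ne'

/-- The finite set of indices carrying the excess. -/
def topSupport (N : ℕ) (ha : (Function.support a).Finite) : Finset V :=
  (support_topPart_finite (N := N) ha).toFinset

lemma mem_topSupport {ha : (Function.support a).Finite} {v : V} :
    v ∈ topSupport N ha ↔ threshold N a < a v := by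
  rw [topSupport, Set.Finite.mem_toFinset, Function.mem_support, ← topPart_pos_iff]
  exact (topPart_nonneg v).lt_iff_ne'.symm

lemma card_topSupport_le (ha : (Function.support a).Finite) : (topSupport N ha).card ≤ N :=
  (threshold_mem ha).2 _ fun _ hw => mem_topSupport.1 hw

lemma topMass_eq_sum (ha : (Function.support a).Finite) {σ : Finset V} (hσ : topSupport N ha ⊆ σ) :
    topMass N a = ∑ v ∈ σ, topPart N a v :=
  finsum_eq_sum_of_support_subset _ fun v hv => hσ (by simpa [topSupport] using hv)

lemma topMass_nonneg : 0 ≤ topMass N a := finsum_nonneg topPart_nonneg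

lemma topPart_le_topMass (ha : (Function.support a).Finite) (v : V) :
    topPart N a v ≤ topMass N a := by
  classical
  rw [topMass_eq_sum ha (Finset.subset_insert v _)]
  exact Finset.single_le_sum (fun w _ => topPart_nonneg w) (Finset.mem_insert_self v _)

lemma sum_abs_topPart_sub_le [DecidableEq V] (ha : (Function.support a).Finite)
    (ha' : (Function.support a').Finite) (h : ∀ v, |a' v - a v| ≤ η) (hη : 0 ≤ η) (σ : Finset V) :
    ∑ v ∈ σ, |topPart N a' v - topPart N a v| ≤ 4 * N * η := by
  set τ := topSupport N ha ∪ topSupport N ha'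
  have h0 : ∀ v ∉ τ, |topPart N a' v - topPart N a v| = 0 := fun v hv => by
    simp only [τ, Finset.mem_union, not_or, mem_topSupport, ← topPart_pos_iff] at hv
    rw [le_antisymm (not_lt.1 hv.1) (topPart_nonneg v),
      le_antisymm (not_lt.1 hv.2) (topPart_nonneg v)]
    simp
  calc ∑ v ∈ σ, |topPart N a' v - topPart N a v|
      ≤ ∑ v ∈ σ ∪ τ, |topPart N a' v - topPart N a v| :=
        Finset.sum_le_sum_of_subset_of_nonneg Finset.subset_union_left fun _ _ _ => abs_nonneg _
    _ = ∑ v ∈ τ, |topPart N a' v - topPart N a v| :=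
        (Finset.sum_subset Finset.subset_union_right fun v _ hv => h0 v hv).symm
    _ ≤ τ.card • (2 * η) :=
        Finset.sum_le_card_nsmul _ _ _ fun v _ => abs_topPart_sub_le ha ha' h hη v
    _ ≤ (2 * N : ℕ) • (2 * η) := by
        gcongr
        have := Finset.card_union_le (topSupport N ha) (topSupport N ha')
        have h1 := card_topSupport_le (N := N) ha
        have h2 := card_topSupport_le (N := N) ha'
        simp only [τ]
        omega
    _ = 4 * N * η := by push_cast [nsmul_eq_mul]; ring

lemma abs_topMass_sub_le (ha : (Function.support a).Finite) (ha' : (Function.support a').Finite)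
    (h : ∀ v, |a' v - a v| ≤ η) (hη : 0 ≤ η) : |topMass N a' - topMass N a| ≤ 4 * N * η := by
  classical
  rw [topMass_eq_sum ha' Finset.subset_union_right,
    topMass_eq_sum ha Finset.subset_union_left, ← Finset.sum_sub_distrib]
  exact (Finset.abs_sum_le_sum_abs _ _).trans (sum_abs_topPart_sub_le ha ha' h hη _)

lemma topWeight_mem_simplexOn (ha : (Function.support a).Finite) (h0 : 0 < topMass N a)
    {σ : Finset V} (hσ : topSupport N ha ⊆ σ) : topWeight N a ∈ simplexOn σ := by
  refine ⟨fun v => div_nonneg (topPart_nonneg v) h0.le, fun v hv => ?_, ?_⟩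
  · have : ¬ 0 < topPart N a v := fun h => hv (hσ (mem_topSupport.2 (topPart_pos_iff.1 h)))
    rw [topWeight, le_antisymm (not_lt.1 this) (topPart_nonneg v), zero_div]
  · simp only [topWeight]
    rw [← Finset.sum_div, ← topMass_eq_sum ha hσ, div_self h0.ne']

lemma topWeight_eq_zero (h0 : topMass N a = 0) : topWeight N a = 0 := by
  ext v; simp [topWeight, h0]

lemma sum_abs_topWeight_sub_le (ha : (Function.support a).Finite)
    (ha' : (Function.support a').Finite) (h : ∀ v, |a' v - a v| ≤ η) (hη : 0 ≤ η)
    (h0 : 0 < topMass N a) (h0' : 0 < topMass N a') {σ : Finset V} (hσ : topSupport N ha' ⊆ σ) :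
    ∑ v ∈ σ, |topWeight N a' v - topWeight N a v| ≤ 8 * N * η / topMass N a := by
  classical
  have key : ∀ v, |topWeight N a' v - topWeight N a v| ≤
      |topPart N a' v - topPart N a v| / topMass N a +
        topPart N a' v * (|topMass N a' - topMass N a| / (topMass N a * topMass N a')) := by
    intro v
    have e : topWeight N a' v - topWeight N a v =
        (topPart N a' v - topPart N a v) / topMass N a +
          -(topPart N a' v * ((topMass N a' - topMass N a) / (topMass N a * topMass N a'))) := by
      simp only [topWeight]; field_simp; ring
    rw [e]
    refine (abs_add_le _ _).trans_eq ?_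
    rw [abs_neg, abs_mul, abs_div, abs_div, abs_of_pos h0, abs_of_nonneg (topPart_nonneg v),
      abs_of_pos (mul_pos h0 h0')]
  calc _ ≤ _ := Finset.sum_le_sum fun v _ => key v
    _ = (∑ v ∈ σ, |topPart N a' v - topPart N a v|) / topMass N a +
        |topMass N a' - topMass N a| / topMass N a := by
      rw [Finset.sum_add_distrib, ← Finset.sum_div, ← Finset.sum_mul, ← topMass_eq_sum ha' hσ]
      field_simp
    _ ≤ (4 * N * η) / topMass N a + (4 * N * η) / topMass N a := by
      gcongr
      · exact sum_abs_topPart_sub_le ha ha' h hη σ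
      · exact abs_topMass_sub_le ha ha' h hη
    _ = _ := by ring

/-- If the total excess is small, then `N + 1` large values of `a` are close to each other. -/
lemma exists_close_of_topMass_lt (ha : (Function.support a).Finite) {v₀ : V}
    (hv₀ : 1 ≤ a v₀) (h : topMass N a < 1 / 2) :
    ∃ T : Finset V, T.card = N + 1 ∧ (∀ w ∈ T, 0 < a w) ∧
      ∃ v ∈ T, ∀ w ∈ T, |a w - a v| ≤ topMass N a := by
  classical
  have hτ : 0 < threshold N a := by
    have h1 := topPart_le_topMass (N := N) ha v₀
    have h2 : a v₀ - threshold N a ≤ topPart N a v₀ := le_max_right _ _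
    linarith
  have hT : ∃ T : Finset V, T.card = N + 1 ∧ ∀ w ∈ T, threshold N a ≤ a w := by
    by_contra hcon
    push Not at hcon
    set R : Finset ℝ := insert 0 ((ha.toFinset.filter fun w => a w < threshold N a).image a)
    have hR : R.Nonempty := Finset.insert_nonempty _ _
    have hlt : R.max' hR < threshold N a := by
      rw [Finset.max'_lt_iff]
      intro r hr
      rcases Finset.mem_insert.1 hr with rfl | hr
      · exact hτ
      · obtain ⟨w, hw, rfl⟩ := Finset.mem_image.1 hr
        exact (Finset.mem_filter.1 hw).2
    have h0 : 0 ≤ R.max' hR := R.le_max' 0 (Finset.mem_insert_self _ _)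
    refine (csInf_le bddBelow_levelSet (⟨h0, fun T hT => ?_⟩ : R.max' hR ∈ levelSet N a)).not_gt hlt
    by_contra hcard
    obtain ⟨T', hT', hc⟩ := Finset.exists_subset_card_eq (show N + 1 ≤ T.card by omega)
    obtain ⟨w, hw, hwlt⟩ := hcon T' hc
    have hw' := hT w (hT' hw)
    refine (R.le_max' (a w) (Finset.mem_insert_of_mem (Finset.mem_image_of_mem a
      (Finset.mem_filter.2 ⟨?_, hwlt⟩)))).not_gt hw'
    exact ha.mem_toFinset.2 (h0.trans_lt hw').ne'
  obtain ⟨T, hTc, hTa⟩ := hT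
  obtain ⟨v, hv, hva⟩ : ∃ v ∈ T, a v ≤ threshold N a := by
    by_contra hcon
    push Not at hcon
    have := (threshold_mem ha).2 T hcon
    omega
  refine ⟨T, hTc, fun w hw => hτ.trans_le (hTa w hw), v, hv, fun w hw => ?_⟩
  have h1 := topPart_le_topMass (N := N) ha w
  have h2 : a w - threshold N a ≤ topPart N a w := le_max_right _ _
  rw [abs_le]
  constructor <;> linarith [hTa w hw, hTa v hv]

end TopWeights

section Lattice

variable {m : ℕ}

/-- Indices of dyadic-type vertices: a scale and a lattice point. -/
abbrev Cell (m : ℕ) := ℤ × (Fin m → ℤ)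

/-- A finite palette distinguishing nearby cells. -/
abbrev Colour (m : ℕ) := ZMod 6 × (Fin m → ZMod 6)

/-- The colour of a cell. -/
def Cell.colour (v : Cell m) : Colour m := (v.1, fun i => v.2 i)

/-- The distance of `(s, x)` to a cell, after rescaling. -/
def cellDist (s : ℝ) (x : Euc m) (v : Cell m) : ℝ :=
  max ‖(fun i => Real.exp v.1 * x i - v.2 i : Fin m → ℝ)‖ |s + v.1|

/-- The weight of a cell, with perturbation `θ`. -/
def cellWeight (θ : Colour m → ℝ) (s : ℝ) (x : Euc m) (v : Cell m) : ℝ :=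
  max 0 (θ v.colour + 2 - cellDist s x v)

/-- The centre of a cell. -/
def Cell.centre (v : Cell m) : Euc m := WithLp.toLp 2 fun i => Real.exp (-v.1) * v.2 i

lemma abs_coord_le_cellDist (s : ℝ) (x : Euc m) (v : Cell m) (i : Fin m) :
    |Real.exp v.1 * x i - v.2 i| ≤ cellDist s x v :=
  (norm_le_pi_norm (fun i => Real.exp v.1 * x i - v.2 i : Fin m → ℝ) i).trans (le_max_left _ _)

lemma abs_scale_le_cellDist (s : ℝ) (x : Euc m) (v : Cell m) : |s + v.1| ≤ cellDist s x v :=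
  le_max_right _ _

lemma int_eq_of_zmod_six {a b : ℤ} (h : (a : ZMod 6) = b) (hab : |(a : ℝ) - b| < 6) : a = b := by
  rw [ZMod.intCast_eq_intCast_iff_dvd_sub] at h
  have h6 : |a - b| < 6 := by exact_mod_cast hab
  rw [abs_lt] at h6
  push_cast at h
  omega

lemma colour_injOn (s : ℝ) (x : Euc m) : InjOn Cell.colour {v : Cell m | cellDist s x v < 3} := by
  intro v hv w hw h
  simp only [mem_ofPred_eq] at hv hw
  have key : ∀ {a b t : ℝ}, |t - a| < 3 → |t - b| < 3 → |a - b| < 6 := fun h1 h2 => by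
    rw [abs_lt] at *; constructor <;> linarith
  have h1 : v.1 = w.1 := by
    refine int_eq_of_zmod_six (congrArg Prod.fst h) (key (t := -s) ?_ ?_)
    · rw [show -s - (v.1 : ℝ) = -(s + v.1) by ring, abs_neg]
      exact (abs_scale_le_cellDist s x v).trans_lt hv
    · rw [show -s - (w.1 : ℝ) = -(s + w.1) by ring, abs_neg]
      exact (abs_scale_le_cellDist s x w).trans_lt hw
  refine Prod.ext h1 (funext fun i => int_eq_of_zmod_six (congrFun (congrArg Prod.snd h) i)
    (key (t := Real.exp v.1 * x i) ((abs_coord_le_cellDist s x v i).trans_lt hv) ?_))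
  rw [h1]
  exact (abs_coord_le_cellDist s x w i).trans_lt hw

lemma cellDist_lt_of_cellWeight_pos {θ : Colour m → ℝ} (hθ : ∀ i, θ i ∈ Icc (0 : ℝ) 1) {s : ℝ}
    {x : Euc m} {v : Cell m} (h : 0 < cellWeight θ s x v) : cellDist s x v < 3 := by
  have h1 := (lt_max_iff.1 h).resolve_left (lt_irrefl _)
  linarith [(hθ v.colour).2]

lemma cellWeight_of_pos {θ : Colour m → ℝ} {s : ℝ} {x : Euc m} {v : Cell m}
    (h : 0 < cellWeight θ s x v) : cellWeight θ s x v = θ v.colour + 2 - cellDist s x v :=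
  max_eq_right ((lt_max_iff.1 h).resolve_left (lt_irrefl _)).le

lemma cellWeight_nonneg {θ : Colour m → ℝ} {s : ℝ} {x : Euc m} {v : Cell m} :
    0 ≤ cellWeight θ s x v := le_max_left _ _

lemma cellWeight_support_finite {θ : Colour m → ℝ} (hθ : ∀ i, θ i ∈ Icc (0 : ℝ) 1) (s : ℝ)
    (x : Euc m) : (Function.support (cellWeight θ s x)).Finite := by
  refine Set.Finite.of_finite_image (f := Cell.colour) (Set.toFinite _)
    ((colour_injOn s x).mono fun v hv => ?_)
  exact cellDist_lt_of_cellWeight_pos hθ (cellWeight_nonneg.lt_of_ne' hv)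

lemma exists_one_le_cellWeight {θ : Colour m → ℝ} (hθ : ∀ i, θ i ∈ Icc (0 : ℝ) 1) (s : ℝ)
    (x : Euc m) : ∃ v, 1 ≤ cellWeight θ s x v := by
  refine ⟨(-round s, fun i => round (Real.exp (-round s : ℤ) * x i)), le_max_of_le_right ?_⟩
  have : cellDist s x (-round s, fun i => round (Real.exp (-round s : ℤ) * x i)) ≤ 1 / 2 := by
    refine max_le ((pi_norm_le_iff_of_nonneg (by norm_num)).2 fun i => ?_) ?_
    · exact abs_sub_round _
    · simpa [sub_eq_add_neg] using abs_sub_round s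
  linarith [(hθ (Cell.colour (-round s, fun i => round (Real.exp (-round s : ℤ) * x i)))).1]

lemma abs_cellWeight_sub_le_of_cellDist {θ : Colour m → ℝ} {s s' : ℝ} {x x' : Euc m} {v : Cell m} :
    |cellWeight θ s' x' v - cellWeight θ s x v| ≤ |cellDist s' x' v - cellDist s x v| := by
  have h3 := abs_max_sub_max_le_abs (θ v.colour + 2 - cellDist s' x' v)
    (θ v.colour + 2 - cellDist s x v) 0
  rw [max_comm _ 0, max_comm _ 0] at h3
  refine h3.trans_eq ?_
  rw [sub_sub_sub_cancel_left, abs_sub_comm]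

lemma abs_cellWeight_sub_le_of_perturbation {θ θ' : Colour m → ℝ} {s : ℝ} {x : Euc m} {v : Cell m} :
    |cellWeight θ' s x v - cellWeight θ s x v| ≤ |θ' v.colour - θ v.colour| := by
  have h3 := abs_max_sub_max_le_abs (θ' v.colour + 2 - cellDist s x v)
    (θ v.colour + 2 - cellDist s x v) 0
  rw [max_comm _ 0, max_comm _ 0] at h3
  refine h3.trans_eq ?_
  congr 1; ring

lemma abs_cellDist_sub_le {s s' : ℝ} {x x' : Euc m} {v : Cell m} :
    |cellDist s' x' v - cellDist s x v| ≤ max (Real.exp v.1 * dist x' x) |s' - s| := by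
  refine (abs_max_sub_max_le_max _ _ _ _).trans (max_le_max ?_ ?_)
  · refine (abs_norm_sub_norm_le _ _).trans
      ((pi_norm_le_iff_of_nonneg (by positivity)).2 fun i => ?_)
    have : Real.exp v.1 * x' i - v.2 i - (Real.exp v.1 * x i - v.2 i) =
        Real.exp v.1 * (x' i - x i) := by ring
    simp only [Pi.sub_apply, this, norm_mul, Real.norm_eq_abs, Real.abs_exp]
    gcongr
    rw [dist_eq_norm]
    exact PiLp.norm_apply_le (x' - x) i
  · refine (abs_abs_sub_abs_le _ _).trans_eq ?_
    congr 1; ring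

lemma abs_cellWeight_sub_le {θ : Colour m → ℝ} (hθ : ∀ i, θ i ∈ Icc (0 : ℝ) 1) {r r' : ℝ}
    {x x' : Euc m} (hr : 0 < r) (hx : dist x' x ≤ r / 2) (hrr : |r' - r| ≤ dist x' x) (v : Cell m) :
    |cellWeight θ (Real.log r') x' v - cellWeight θ (Real.log r) x v| ≤ 81 / r * dist x' x := by
  have hr1 : r / 2 ≤ r' := by linarith [(abs_le.1 hrr).1]
  have hr' : 0 < r' := by linarith
  have hlog : |Real.log r' - Real.log r| ≤ 2 / r * dist x' x := by
    have h1 : Real.log r' - Real.log r ≤ (r' - r) / r := by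
      rw [← Real.log_div hr'.ne' hr.ne', sub_div, div_self hr.ne']
      exact Real.log_le_sub_one_of_pos (by positivity)
    have h2 : Real.log r - Real.log r' ≤ (r - r') / r' := by
      rw [← Real.log_div hr.ne' hr'.ne', sub_div, div_self hr'.ne']
      exact Real.log_le_sub_one_of_pos (by positivity)
    have h3 : (r' - r) / r ≤ 2 / r * dist x' x := by
      rw [div_mul_eq_mul_div]; gcongr
      linarith [(abs_le.1 hrr).2, dist_nonneg (x := x') (y := x)]
    have h4 : (r - r') / r' ≤ 2 / r * dist x' x := by
      calc (r - r') / r' ≤ dist x' x / r' := by gcongr; linarith [(abs_le.1 hrr).1]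
        _ ≤ dist x' x / (r / 2) := by gcongr
        _ = _ := by field_simp
    exact abs_le.2 ⟨by linarith, by linarith⟩
  have hlog1 : |Real.log r' - Real.log r| ≤ 1 := hlog.trans <| by
    calc 2 / r * dist x' x ≤ 2 / r * (r / 2) := by gcongr
      _ = 1 := by field_simp
  by_cases hv : |Real.log r + v.1| < 4
  · refine abs_cellWeight_sub_le_of_cellDist.trans (abs_cellDist_sub_le.trans (max_le ?_ ?_))
    · gcongr
      have h1 : (v.1 : ℝ) ≤ 4 - Real.log r := by linarith [(abs_lt.1 hv).2]
      calc Real.exp v.1 ≤ Real.exp (4 - Real.log r) := Real.exp_le_exp.2 h1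
        _ = Real.exp 1 ^ 4 / r := by
          rw [Real.exp_sub, Real.exp_log hr, ← Real.exp_nat_mul]; norm_num
        _ ≤ 3 ^ 4 / r := by gcongr; exact Real.exp_one_lt_three.le
        _ = 81 / r := by norm_num
    · exact hlog.trans (by gcongr; norm_num)
  · have h1 : cellWeight θ (Real.log r) x v = 0 := by
      refine le_antisymm (not_lt.1 fun h => hv ?_) cellWeight_nonneg
      linarith [cellDist_lt_of_cellWeight_pos hθ h, abs_scale_le_cellDist (Real.log r) x v]
    have h2 : cellWeight θ (Real.log r') x' v = 0 := by
      refine le_antisymm (not_lt.1 fun h => hv ?_) cellWeight_nonneg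
      have h3 := abs_add_le (Real.log r' + v.1) (Real.log r - Real.log r')
      rw [abs_sub_comm] at h3
      rw [show Real.log r' + v.1 + (Real.log r - Real.log r') = Real.log r + v.1 by ring] at h3
      linarith [cellDist_lt_of_cellWeight_pos hθ h, abs_scale_le_cellDist (Real.log r') x' v]
    rw [h1, h2, sub_self, abs_zero]; positivity

lemma dist_centre_le {r : ℝ} (hr : 0 < r) {x : Euc m} {v : Cell m}
    (h : cellDist (Real.log r) x v < 3) : dist v.centre x ≤ 81 * m * r := by
  have h1 : Real.exp (-v.1) ≤ 27 * r := by
    have : (-v.1 : ℝ) ≤ 3 + Real.log r := by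
      linarith [(abs_lt.1 ((abs_scale_le_cellDist _ _ _).trans_lt h)).1]
    calc Real.exp (-v.1) ≤ Real.exp (3 + Real.log r) := Real.exp_le_exp.2 this
      _ = Real.exp 1 ^ 3 * r := by
        rw [Real.exp_add, Real.exp_log hr, ← Real.exp_nat_mul]; norm_num
      _ ≤ 3 ^ 3 * r := by gcongr; exact Real.exp_one_lt_three.le
      _ = 27 * r := by norm_num
  have h2 : ∀ i, |v.centre i - x i| ≤ 81 * r := fun i => by
    have e : v.centre i - x i = -(Real.exp (-v.1) * (Real.exp v.1 * x i - v.2 i)) := by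
      have : Real.exp (-v.1) * Real.exp v.1 = 1 := by rw [← Real.exp_add]; simp
      simp only [Cell.centre]
      linear_combination x i * this
    rw [e, abs_neg, abs_mul, Real.abs_exp]
    calc _ ≤ 27 * r * 3 := by
          gcongr
          exact (abs_coord_le_cellDist _ _ _ _).trans h.le
      _ = _ := by ring
  rw [EuclideanSpace.dist_eq]
  refine Real.sqrt_le_sqrt (Finset.sum_le_sum fun i _ => ?_) |>.trans
    (?_ : √(∑ i : Fin m, (81 * r) ^ 2) ≤ _)
  · rw [Real.dist_eq]; gcongr; exact h2 i
  · rw [Finset.sum_const, Finset.card_univ, Fintype.card_fin, nsmul_eq_mul]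
    refine Real.sqrt_le_iff.2 ⟨by positivity, ?_⟩
    have hm : (m : ℝ) ≤ (m : ℝ) ^ 2 := by exact_mod_cast Nat.le_self_pow two_ne_zero m
    nlinarith [sq_nonneg (81 * r)]

end Lattice

section Filling

variable {m : ℕ}

open Classical in
/-- The gap function: total excess of the cell weights, set to one on `Z`. -/
def gap (n : ℕ) (Z : Set (Euc m)) (θ : Colour m → ℝ) (x : Euc m) : ℝ :=
  if x ∈ Z then 1 else topMass (n + 1) (cellWeight θ (Real.log (infDist x Z)) x)

lemma gap_of_mem {n : ℕ} {Z : Set (Euc m)} {θ : Colour m → ℝ} {x : Euc m} (hx : x ∈ Z) :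
    gap n Z θ x = 1 := if_pos hx

lemma gap_of_notMem {n : ℕ} {Z : Set (Euc m)} {θ : Colour m → ℝ} {x : Euc m} (hx : x ∉ Z) :
    gap n Z θ x = topMass (n + 1) (cellWeight θ (Real.log (infDist x Z)) x) := if_neg hx

lemma infDist_pos_of_notMem {Z : Set (Euc m)} (hZ : IsClosed Z) (hne : Z.Nonempty) {x : Euc m}
    (hx : x ∉ Z) : 0 < infDist x Z := (hZ.notMem_iff_infDist_pos hne).1 hx

lemma notMem_of_dist_le {Z : Set (Euc m)} (hZ : IsClosed Z) (hne : Z.Nonempty) {x y : Euc m}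
    (hx : x ∉ Z) (h : dist y x ≤ infDist x Z / 2) : y ∉ Z := fun hy => by
  have h1 := infDist_le_dist_of_mem (x := x) hy
  rw [dist_comm] at h1
  linarith [infDist_pos_of_notMem hZ hne hx]

lemma abs_cellWeight_infDist_sub_le {Z : Set (Euc m)} (hZ : IsClosed Z) (hne : Z.Nonempty)
    {θ : Colour m → ℝ} (hθ : ∀ i, θ i ∈ Icc (0 : ℝ) 1) {x y : Euc m} (hx : x ∉ Z)
    (h : dist y x ≤ infDist x Z / 2) (v : Cell m) :
    |cellWeight θ (Real.log (infDist y Z)) y v - cellWeight θ (Real.log (infDist x Z)) x v| ≤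
      81 / infDist x Z * dist y x := by
  refine abs_cellWeight_sub_le hθ (infDist_pos_of_notMem hZ hne hx) h ?_ v
  rw [abs_sub_le_iff]
  constructor
  · linarith [infDist_le_infDist_add_dist (s := Z) (x := y) (y := x)]
  · linarith [infDist_le_infDist_add_dist (s := Z) (x := x) (y := y), dist_comm x y]

/-- Filling in a Lipschitz map with the help of barycentric weights on cells. -/
theorem exists_gapControlled (n : ℕ) {c : ℝ} (hc : 1 ≤ c) (m : ℕ) :
    ∃ A : ℝ, 0 ≤ A ∧ ∀ Z : Set (Euc m), IsCompact Z → Z.Nonempty →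
      ∀ (Y : Type) [MetricSpace Y], LipschitzConnected n c Y → ∀ L : ℝ, 0 ≤ L → ∀ f : Euc m → Y,
        (∀ x ∈ Z, ∀ y ∈ Z, dist (f x) (f y) ≤ L * dist x y) →
        ∀ θ : Colour m → ℝ, (∀ i, θ i ∈ Icc (0 : ℝ) 1) →
          ∃ F : Euc m → Y, GapControlled Z F (gap n Z θ) (A * L) ∧ (∀ x ∈ Z, F x = f x) ∧
            ∀ x ∉ Z, ∀ y ∉ Z, gap n Z θ x = 0 → gap n Z θ y = 0 → F x = F y := by
  classical
  obtain ⟨C, hC, hfill⟩ := exists_barycentric_filling n hc n le_rfl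
  set P : ℝ := 2 * (81 * m) + 1 with hP
  have hP0 : 1 ≤ P := by simp only [hP]; linarith [(Nat.cast_nonneg m : (0 : ℝ) ≤ m)]
  set N : ℕ := n + 1 with hN
  refine ⟨C * (2 * P) * 2 * (8 * N * 81) + C * (2 * P) * 2 + (P + 1) + 1, by positivity, ?_⟩
  intro Z hZ hne Y _ hY L hL f hf θ hθ
  set A := C * (2 * P) * 2 * (8 * N * 81) + C * (2 * P) * 2 + (P + 1) + 1 with hA
  have hZc := hZ.isClosed
  choose z hzZ hz using fun v : Cell m => hZ.exists_infDist_eq_dist hne v.centre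
  obtain ⟨E, hE1, hE2⟩ := hfill Y hY (fun v => f (z v))
  set δ : Euc m → ℝ := fun x => infDist x Z with hδ
  set a : Euc m → Cell m → ℝ := fun x => cellWeight θ (Real.log (δ x)) x with ha
  have hδ0 : ∀ {x}, x ∉ Z → 0 < δ x := fun hx => infDist_pos_of_notMem hZc hne hx
  have hfin : ∀ x, (Function.support (a x)).Finite := fun x => cellWeight_support_finite hθ _ _
  set σ : Euc m → Finset (Cell m) := fun x => topSupport N (hfin x) with hσ
  have hnear : ∀ {x}, x ∉ Z → ∀ v ∈ σ x, dist x (z v) ≤ P * δ x := by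
    intro x hx v hv
    have hv0 : 0 < a x v := threshold_nonneg.trans_lt (mem_topSupport.1 hv)
    have h1 := dist_centre_le (hδ0 hx) (cellDist_lt_of_cellWeight_pos hθ hv0)
    have h2 := infDist_le_infDist_add_dist (s := Z) (x := v.centre) (y := x)
    have h3 := dist_triangle x v.centre (z v)
    rw [← hz v, dist_comm x v.centre] at h3
    calc dist x (z v) ≤ 2 * (81 * m * δ x) + δ x := by linarith
      _ = P * δ x := by rw [hP]; ring
  have hD : ∀ {x}, x ∉ Z → ∀ v ∈ σ x, ∀ w ∈ σ x,
      dist (f (z v)) (f (z w)) ≤ L * (2 * P * δ x) := by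
    intro x hx v hv w hw
    refine (hf _ (hzZ v) _ (hzZ w)).trans ?_
    gcongr
    linarith [dist_triangle_left (z v) (z w) x, hnear hx v hv, hnear hx w hw]
  set G := gap n Z θ with hG
  have hGZ : ∀ {x}, x ∉ Z → G x = topMass N (a x) := fun hx => gap_of_notMem hx
  have hcard : ∀ x, (σ x).card ≤ n + 1 := fun x => card_topSupport_le (hfin x)
  set F : Euc m → Y := fun x => if x ∈ Z then f x else E (topWeight N (a x)) with hF
  have hFZ : ∀ {x}, x ∈ Z → F x = f x := fun hx => if_pos hx
  have hFn : ∀ {x}, x ∉ Z → F x = E (topWeight N (a x)) := fun hx => if_neg hx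
  have hev : ∀ {x}, x ∉ Z → ∀ᶠ y in 𝓝 x, dist y x ≤ δ x / 2 := fun hx =>
    Metric.closedBall_mem_nhds _ (half_pos (hδ0 hx))
  have hη : ∀ {x y}, x ∉ Z → dist y x ≤ δ x / 2 → ∀ v, |a y v - a x v| ≤ 81 / δ x * dist y x :=
    fun hx hy v => abs_cellWeight_infDist_sub_le hZc hne hθ hx hy v
  have hη0 : ∀ x y : Euc m, 0 ≤ 81 / δ x * dist y x := fun x y =>
    mul_nonneg (div_nonneg (by norm_num) infDist_nonneg) dist_nonneg
  refine ⟨F, ⟨hZc, by positivity, fun x => ?_, fun x hx => gap_of_mem hx, fun x hx => ?_,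
    fun x hx hGx => ?_, fun x hGx w hw => ?_⟩, fun x hx => hFZ hx, fun x hx y hy hGx hGy => ?_⟩
  · by_cases hx : x ∈ Z
    · rw [hG, gap_of_mem hx]; norm_num
    · rw [hGZ hx]; exact topMass_nonneg
  · refine ⟨4 * N * (81 / δ x), (hev hx).mono fun y hy => ?_⟩
    rw [hGZ hx, hGZ (notMem_of_dist_le hZc hne hx hy), mul_assoc]
    exact abs_topMass_sub_le (hfin x) (hfin y) (hη hx hy) (hη0 x y)
  · have hGx' := hGx
    rw [hGZ hx] at hGx'
    have hsupp : ∀ᶠ y in 𝓝 x, ∀ v ∈ σ x, 2 * (81 / δ x * dist y x) < topPart N (a x) v := by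
      refine (Finset.eventually_all (σ x)).2 fun v hv => ?_
      have ht : Tendsto (fun y => 2 * (81 / δ x * dist y x)) (𝓝 x) (𝓝 0) := by
        have : Continuous fun y => 2 * (81 / δ x * dist y x) := by fun_prop
        simpa using this.tendsto x
      exact ht.eventually_lt_const (topPart_pos_iff.2 (mem_topSupport.1 hv))
    filter_upwards [hev hx, hsupp] with y hy hs
    have hyZ := notMem_of_dist_le hZc hne hx hy
    have hsub : σ x ⊆ σ y := fun v hv => by
      have h1 := abs_topPart_sub_le (N := N) (hfin x) (hfin y) (hη hx hy) (hη0 x y) v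
      refine mem_topSupport.2 (topPart_pos_iff.1 ?_)
      linarith [hs v hv, (abs_le.1 h1).1]
    have hGy : 0 < topMass N (a y) := by
      obtain ⟨v, hv⟩ := nonempty_of_mem_simplexOn
        (topWeight_mem_simplexOn (hfin x) hGx' (Finset.Subset.refl (σ x)))
      exact (topPart_pos_iff.2 (mem_topSupport.1 (hsub hv))).trans_le
        (topPart_le_topMass (hfin y) v)
    rw [hFn hx, hFn hyZ, hGZ hx]
    have h1 := hE2 (σ y) (hcard y) _ (hD hyZ) _
      (topWeight_mem_simplexOn (hfin y) hGy (Finset.Subset.refl (σ y))) _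
      (topWeight_mem_simplexOn (hfin x) hGx' hsub)
    have h2 := sum_abs_topWeight_sub_le (hfin x) (hfin y) (hη hx hy) (hη0 x y) hGx' hGy
      (Finset.Subset.refl (σ y))
    have h3 : δ y ≤ 2 * δ x := by
      have := infDist_le_infDist_add_dist (s := Z) (x := y) (y := x)
      have h4 : dist y x ≤ δ x / 2 := hy
      change δ y ≤ δ x + dist y x at this
      linarith [hδ0 hx]
    have hdx := hδ0 hx
    calc _ ≤ _ := h1
      _ ≤ C * (L * (2 * P * (2 * δ x))) * (8 * N * (81 / δ x * dist y x) / topMass N (a x)) := by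
        gcongr
      _ = (C * (2 * P) * 2 * (8 * N * 81)) * L / topMass N (a x) * dist y x := by
        field_simp
      _ ≤ A * L / topMass N (a x) * dist y x := by
        gcongr
        rw [hA]
        have : 0 ≤ C * (2 * P) * 2 := by positivity
        linarith
  · have hA1 : 1 ≤ A := by
      have : 0 ≤ C * (2 * P) * 2 * (8 * N * 81) + C * (2 * P) * 2 := by positivity
      linarith
    by_cases hx : x ∈ Z
    · rw [hFZ hx, hFZ hw]
      refine (hf x hx w hw).trans ?_
      gcongr
      exact le_mul_of_one_le_left hL hA1
    · rw [hFn hx, hFZ hw]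
      rw [hGZ hx] at hGx
      have hmem := topWeight_mem_simplexOn (hfin x) hGx (Finset.Subset.refl (σ x))
      obtain ⟨v, hv⟩ := nonempty_of_mem_simplexOn hmem
      have hvm : (Pi.single v 1 : Cell m → ℝ) ∈ simplexOn {v} := by
        refine ⟨fun u => ?_, fun u hu => ?_, by simp⟩
        · by_cases h : u = v
          · subst h; simp
          · simp [h]
        · simp only [Finset.mem_singleton] at hu
          simp [hu]
      have hvm' : (Pi.single v 1 : Cell m → ℝ) ∈ simplexOn (σ x) := by
        refine ⟨hvm.1, fun u hu => ?_, ?_⟩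
        · exact hvm.2.1 u fun h => hu (Finset.mem_singleton.1 h ▸ hv)
        · simp [hv]
      have h1 := hE2 (σ x) (hcard x) _ (hD hx) _ hmem _ hvm'
      rw [hE1 v _ hvm] at h1
      have h2 : ∑ u ∈ σ x, |topWeight N (a x) u - (Pi.single v 1 : Cell m → ℝ) u| ≤ 2 := by
        calc _ ≤ ∑ u ∈ σ x, (topWeight N (a x) u + (Pi.single v 1 : Cell m → ℝ) u) := by
              refine Finset.sum_le_sum fun u _ => ?_
              have h3 := hmem.1 u
              have h4 := hvm'.1 u
              exact abs_le.2 ⟨by linarith, by linarith⟩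
          _ = 2 := by rw [Finset.sum_add_distrib, hmem.2.2, hvm'.2.2]; norm_num
      have h3 := hf _ (hzZ v) _ hw
      have h4 : δ x ≤ dist x w := infDist_le_dist_of_mem hw
      have h5 : dist (z v) w ≤ (P + 1) * dist x w := by
        have := dist_triangle_left (z v) w x
        have h6 := hnear hx v hv
        have h7 : P * δ x ≤ P * dist x w := by gcongr
        linarith
      have hdx := hδ0 hx
      calc _ ≤ _ := dist_triangle _ (f (z v)) _
        _ ≤ C * (L * (2 * P * dist x w)) * 2 + L * ((P + 1) * dist x w) := by
          refine add_le_add (h1.trans ?_) (h3.trans ?_)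
          · gcongr
          · gcongr
        _ = (C * (2 * P) * 2 + (P + 1)) * L * dist x w := by ring
        _ ≤ A * L * dist x w := by
          gcongr
          rw [hA]
          have : 0 ≤ C * (2 * P) * 2 * (8 * N * 81) := by positivity
          linarith
  · rw [hGZ hx] at hGx
    rw [hGZ hy] at hGy
    rw [hFn hx, hFn hy, topWeight_eq_zero hGx, topWeight_eq_zero hGy]

end Filling

section RandomPerturbation

open scoped ENNReal

lemma exists_lintegral_inv_rpow_le {q : ℝ} (hq : 0 ≤ q) (hq1 : q < 1) :
    ∃ H : ℝ≥0∞, H ≠ ⊤ ∧ ∀ c : ℝ,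
      ∫⁻ t in Icc (0 : ℝ) 1, (ENNReal.ofReal |t - c|)⁻¹ ^ q ≤ H := by
  set k : ℝ → ℝ≥0∞ := (Icc (0 : ℝ) 1).indicator fun t => (ENNReal.ofReal |t|)⁻¹ ^ q with hk
  have hkm : Measurable k := by
    refine Measurable.indicator ?_ measurableSet_Icc
    fun_prop
  have hkfin : ∫⁻ t, k t ≠ ⊤ := by
    have h1 : IntervalIntegrable (fun t : ℝ => t ^ (-q)) volume 0 1 :=
      intervalIntegral.intervalIntegrable_rpow' (by linarith)
    rw [intervalIntegrable_iff_integrableOn_Ioc_of_le zero_le_one] at h1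
    have h2 := h1.2
    rw [hasFiniteIntegral_iff_enorm] at h2
    refine ne_of_lt (lt_of_le_of_lt (le_of_eq ?_) h2)
    rw [hk, lintegral_indicator measurableSet_Icc, ← restrict_Ioc_eq_restrict_Icc]
    refine setLIntegral_congr_fun measurableSet_Ioc fun t ht => ?_
    have ht0 : 0 < t := ht.1
    simp only [abs_of_pos ht0]
    rw [Real.enorm_eq_ofReal (by positivity), Real.rpow_neg ht0.le,
      ENNReal.ofReal_inv_of_pos (by positivity), ENNReal.inv_rpow,
      ENNReal.ofReal_rpow_of_pos ht0]
  refine ⟨(∫⁻ t, k t) + (∫⁻ t, k t) + 1, by finiteness, fun c => ?_⟩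
  have hpt : ∀ t, (ENNReal.ofReal |t - c|)⁻¹ ^ q ≤ k (t - c) + k (c - t) + 1 := by
    intro t
    rcases le_or_gt |t - c| 1 with h | h
    · refine le_add_right ?_
      rcases le_total c t with h0 | h0
      · refine le_add_right (le_of_eq ?_)
        rw [hk, indicator_of_mem]
        exact ⟨sub_nonneg.2 h0, (le_abs_self _).trans h⟩
      · refine le_add_left (le_of_eq ?_)
        rw [hk, indicator_of_mem, abs_sub_comm]
        exact ⟨sub_nonneg.2 h0, (le_abs_self _).trans ((abs_sub_comm _ _).trans_le h)⟩
    · refine le_add_left (ENNReal.rpow_le_one ?_ hq)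
      rw [ENNReal.inv_le_one]
      exact ENNReal.one_le_ofReal.2 h.le
  calc _ ≤ ∫⁻ t in Icc (0 : ℝ) 1, (k (t - c) + k (c - t) + 1) := lintegral_mono hpt
    _ = (∫⁻ t in Icc (0 : ℝ) 1, k (t - c)) + (∫⁻ t in Icc (0 : ℝ) 1, k (c - t)) + 1 := by
      rw [lintegral_add_right _ measurable_const, lintegral_add_right _ (by fun_prop)]
      simp
    _ ≤ (∫⁻ t, k (t - c)) + (∫⁻ t, k (c - t)) + 1 := by
      gcongr <;> exact Measure.restrict_le_self
    _ = _ := by rw [lintegral_sub_right_eq_self, lintegral_sub_left_eq_self]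

lemma measurable_prod_coord {ι : Type*} {i₀ : ι} {h : ι → ℝ → ℝ → ℝ≥0∞}
    (hm : ∀ i, Measurable (Function.uncurry (h i))) (T : Finset ι) :
    Measurable fun y : ι → ℝ => ∏ i ∈ T, h i (y i) (y i₀) := by
  refine Finset.measurable_fun_prod _ fun i _ => ?_
  exact (hm i).comp (f := fun y : ι → ℝ => (y i, y i₀))
    ((measurable_pi_apply i).prodMk (measurable_pi_apply i₀))

/-- Integrating a product of functions, each depending on its own coordinate and on coordinates
outside the index set of the product. -/
lemma lmarginal_prod_le {ι : Type*} [DecidableEq ι] [Fintype ι] {μ : ι → Measure ℝ}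
    [∀ i, SigmaFinite (μ i)]
    {i₀ : ι} {h : ι → ℝ → ℝ → ℝ≥0∞} (hm : ∀ i, Measurable (Function.uncurry (h i)))
    {H : ℝ≥0∞} (hH : ∀ i s, ∫⁻ t, h i t s ∂μ i ≤ H) (T : Finset ι) (hT : i₀ ∉ T) (x : ι → ℝ) :
    (∫⋯∫⁻_T, (fun y => ∏ i ∈ T, h i (y i) (y i₀)) ∂μ) x ≤ H ^ T.card := by
  have hme := measurable_prod_coord (i₀ := i₀) hm
  induction T using Finset.induction_on generalizing x with
  | empty => simp
  | insert j T hj ih =>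
    rw [Finset.mem_insert, not_or] at hT
    rw [lmarginal_insert' _ (hme _) hj]
    have h1 : (fun y : ι → ℝ => ∫⁻ t, ∏ i ∈ insert j T,
        h i (Function.update y j t i) (Function.update y j t i₀) ∂μ j) ≤
        fun y => H * ∏ i ∈ T, h i (y i) (y i₀) := by
      intro y
      have h2 : ∀ t, ∏ i ∈ insert j T,
          h i (Function.update y j t i) (Function.update y j t i₀) =
          h j t (y i₀) * ∏ i ∈ T, h i (y i) (y i₀) := fun t => by
        rw [Finset.prod_insert hj, Function.update_self, Function.update_of_ne hT.1]
        congr 1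
        refine Finset.prod_congr rfl fun i hi => ?_
        rw [Function.update_of_ne (ne_of_mem_of_not_mem hi hj)]
      simp only [h2]
      have h3 : Measurable fun t => h j t (y i₀) :=
        (hm j).comp (f := fun t : ℝ => (t, y i₀)) (measurable_id.prodMk measurable_const)
      rw [lintegral_mul_const _ h3]
      gcongr
      exact hH j _
    calc _ ≤ (∫⋯∫⁻_T, (fun y => H * ∏ i ∈ T, h i (y i) (y i₀)) ∂μ) x := lmarginal_mono h1 x
      _ = H * (∫⋯∫⁻_T, (fun y => ∏ i ∈ T, h i (y i) (y i₀)) ∂μ) x := by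
        rw [lmarginal, lmarginal, lintegral_const_mul]
        exact (hme T).comp measurable_updateFinset
      _ ≤ H * H ^ T.card := by gcongr; exact ih hT.2 x
      _ = _ := by rw [Finset.card_insert_of_notMem hj, pow_succ']

lemma lintegral_pi_prod_le {ι : Type*} [DecidableEq ι] [Fintype ι] {μ : ι → Measure ℝ}
    [∀ i, IsProbabilityMeasure (μ i)]
    {i₀ : ι} {h : ι → ℝ → ℝ → ℝ≥0∞} (hm : ∀ i, Measurable (Function.uncurry (h i)))
    {H : ℝ≥0∞} (hH : ∀ i s, ∫⁻ t, h i t s ∂μ i ≤ H) (T : Finset ι) (hT : i₀ ∉ T) :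
    ∫⁻ y, ∏ i ∈ T, h i (y i) (y i₀) ∂(Measure.pi μ) ≤ H ^ T.card := by
  have hme := measurable_prod_coord (i₀ := i₀) hm T
  rw [lintegral_eq_lmarginal_univ (fun _ => 0), ← Finset.sdiff_union_of_subset (Finset.subset_univ T),
    lmarginal_union _ _ hme Finset.sdiff_disjoint]
  refine (lmarginal_mono (fun x => lmarginal_prod_le hm hH T hT x) _).trans_eq ?_
  simp [lmarginal]

end RandomPerturbation

section RandomGap

open scoped ENNReal

variable {m n : ℕ}

/-- A pointwise bound for the reciprocal of the total excess. -/
lemma inv_topMass_rpow_le {p : ℝ} (hp : 0 ≤ p) (s : ℝ) (x : Euc m) :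
    ∃ b : Colour m → ℝ, ∀ θ : Colour m → ℝ, (∀ i, θ i ∈ Icc (0 : ℝ) 1) →
      (ENNReal.ofReal (topMass (n + 1) (cellWeight θ s x)))⁻¹ ^ p ≤
        2 ^ p + ∑ i₀ : Colour m, ∑ T : Finset (Colour m) with T.card = n + 1 ∧ i₀ ∉ T,
          ∏ i ∈ T, (ENNReal.ofReal |θ i - (θ i₀ + b i - b i₀)|)⁻¹ ^ (p / (n + 1)) := by
  classical
  set A : Set (Cell m) := {v | cellDist s x v < 3}
  have hA := colour_injOn s x
  refine ⟨fun i => cellDist s x (Function.invFunOn Cell.colour A i), fun θ hθ => ?_⟩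
  set g := topMass (n + 1) (cellWeight θ s x) with hg
  rcases le_or_gt (1 / 2) g with hg2 | hg2
  · refine le_add_right (ENNReal.rpow_le_rpow ?_ hp)
    rw [ENNReal.inv_le_iff_inv_le]
    refine le_of_eq_of_le ?_ (ENNReal.ofReal_le_ofReal hg2)
    rw [one_div, ENNReal.ofReal_inv_of_pos two_pos]; simp
  · obtain ⟨v₀, hv₀⟩ := exists_one_le_cellWeight hθ s x
    obtain ⟨T, hTc, hTpos, v, hv, hT⟩ :=
      exists_close_of_topMass_lt (cellWeight_support_finite hθ s x) hv₀ hg2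
    have hTA : ∀ w ∈ T, w ∈ A := fun w hw => cellDist_lt_of_cellWeight_pos hθ (hTpos w hw)
    have hinv : ∀ w ∈ T, Function.invFunOn Cell.colour A w.colour = w := fun w hw =>
      hA.leftInvOn_invFunOn (hTA w hw)
    set T' := (T.erase v).image Cell.colour with hT'
    have hcard : T'.card = n + 1 := by
      rw [hT', Finset.card_image_of_injOn, Finset.card_erase_of_mem hv, hTc]
      · rfl
      · intro a ha b hb hab
        exact hA (hTA a (Finset.mem_of_mem_erase ha)) (hTA b (Finset.mem_of_mem_erase hb)) hab
    have hvT' : v.colour ∉ T' := fun h => by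
      obtain ⟨w, hw, hwv⟩ := Finset.mem_image.1 h
      exact Finset.ne_of_mem_erase hw
        (hA (hTA w (Finset.mem_of_mem_erase hw)) (hTA v hv) hwv)
    refine le_add_left ?_
    refine le_trans ?_ (Finset.single_le_sum (fun _ _ => zero_le) (Finset.mem_univ v.colour))
    refine le_trans ?_ (Finset.single_le_sum (fun _ _ => zero_le)
      (Finset.mem_filter.2 ⟨Finset.mem_univ T', hcard, hvT'⟩))
    have hpow : (ENNReal.ofReal g)⁻¹ ^ p =
        ∏ _i ∈ T', (ENNReal.ofReal g)⁻¹ ^ (p / (n + 1)) := by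
      rw [Finset.prod_const, hcard, ← ENNReal.rpow_mul_natCast]
      congr 1
      push_cast
      field_simp
    rw [hpow]
    refine Finset.prod_le_prod' fun i hi => ?_
    obtain ⟨w, hw, rfl⟩ := Finset.mem_image.1 hi
    have hwT := Finset.mem_of_mem_erase hw
    refine ENNReal.rpow_le_rpow (ENNReal.inv_le_inv.2 (ENNReal.ofReal_le_ofReal ?_)) (by positivity)
    beta_reduce
    rw [hinv w hwT, hinv v hv]
    refine le_of_eq_of_le ?_ (hT w hwT)
    rw [cellWeight_of_pos (hTpos w hwT), cellWeight_of_pos (hTpos v hv)]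
    congr 1; ring

/-- The uniform distribution of perturbations. -/
def perturbationMeasure (m : ℕ) : Measure (Colour m → ℝ) :=
  Measure.pi fun _ => volume.restrict (Icc (0 : ℝ) 1)

instance isProbabilityMeasure_unitInterval :
    IsProbabilityMeasure (volume.restrict (Icc (0 : ℝ) 1)) := ⟨by simp⟩

instance : IsProbabilityMeasure (perturbationMeasure m) := by
  unfold perturbationMeasure; infer_instance

/-- The set of admissible perturbations. -/
def perturbations (m : ℕ) : Set (Colour m → ℝ) := Set.univ.pi fun _ => Icc (0 : ℝ) 1

lemma perturbationMeasure_eq : perturbationMeasure m = volume.restrict (perturbations m) := by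
  rw [perturbationMeasure, perturbations, volume_pi, Measure.restrict_pi_pi]

lemma measurableSet_perturbations : MeasurableSet (perturbations m) :=
  MeasurableSet.univ_pi fun _ => measurableSet_Icc

lemma perturbationMeasure_compl : perturbationMeasure m (perturbations m)ᶜ = 0 := by
  rw [perturbationMeasure_eq, Measure.restrict_apply measurableSet_perturbations.compl]
  simp

theorem exists_lintegral_inv_topMass_le (m n : ℕ) {p : ℝ} (hp : 0 ≤ p) (hpn : p < n + 1) :
    ∃ B : ℝ≥0∞, B ≠ ⊤ ∧ ∀ (s : ℝ) (x : Euc m),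
      ∫⁻ θ, (ENNReal.ofReal (topMass (n + 1) (cellWeight θ s x)))⁻¹ ^ p
        ∂(perturbationMeasure m) ≤ B := by
  classical
  have hq0 : 0 ≤ p / (n + 1) := by positivity
  have hq1 : p / (n + 1) < 1 := (div_lt_one (by positivity)).2 hpn
  obtain ⟨H, hH, hHc⟩ := exists_lintegral_inv_rpow_le hq0 hq1
  refine ⟨2 ^ p + ∑ i₀ : Colour m, ∑ T : Finset (Colour m) with T.card = n + 1 ∧ i₀ ∉ T,
    H ^ T.card, ?_, fun s x => ?_⟩
  · refine ENNReal.add_ne_top.2 ⟨ENNReal.rpow_ne_top_of_nonneg hp (by simp), ?_⟩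
    exact ENNReal.sum_ne_top.2 fun _ _ => ENNReal.sum_ne_top.2 fun _ _ => ENNReal.pow_ne_top hH
  obtain ⟨b, hb⟩ := inv_topMass_rpow_le (n := n) hp s x
  have hae : ∀ᵐ θ ∂(perturbationMeasure m), θ ∈ perturbations m := by
    rw [ae_iff]; exact perturbationMeasure_compl
  refine (lintegral_mono_ae (hae.mono fun θ hθ => hb θ fun i => hθ i (mem_univ i))).trans ?_
  rw [lintegral_add_left measurable_const, lintegral_finsetSum]
  · gcongr with i₀
    · simp
    · rw [lintegral_finsetSum]
      · gcongr with T hT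
        rw [Finset.mem_filter] at hT
        exact lintegral_pi_prod_le (i₀ := i₀)
          (h := fun i t r => (ENNReal.ofReal |t - (r + b i - b i₀)|)⁻¹ ^ (p / (n + 1)))
          (fun i => by unfold Function.uncurry; fun_prop) (fun i r => hHc _) T hT.2.2
      · intro T _
        fun_prop
  · intro i₀ _
    fun_prop

end RandomGap

section ChoiceOfPerturbation

open scoped ENNReal

variable {m n : ℕ}

lemma continuousOn_topMass {Z : Set (Euc m)} (hZ : IsClosed Z) (hne : Z.Nonempty) :
    ContinuousOn (fun q : (Colour m → ℝ) × Euc m =>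
      topMass (n + 1) (cellWeight q.1 (Real.log (infDist q.2 Z)) q.2)) (perturbations m ×ˢ Zᶜ) := by
  rintro ⟨θ, x⟩ ⟨hθ, hx⟩
  have hx : x ∉ Z := hx
  have hfin : ∀ θ ∈ perturbations m, ∀ s (x : Euc m),
      (Function.support (cellWeight θ s x)).Finite :=
    fun θ hθ s x => cellWeight_support_finite (fun i => hθ i (mem_univ i)) s x
  set η : (Colour m → ℝ) × Euc m → ℝ := fun q =>
    dist q.1 θ + 81 / infDist x Z * dist q.2 x with hη
  have hcont : Continuous fun q => 4 * ((n + 1 : ℕ) : ℝ) * η q := by fun_prop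
  rw [ContinuousWithinAt, tendsto_iff_dist_tendsto_zero]
  have hlim : Tendsto (fun q => 4 * ((n + 1 : ℕ) : ℝ) * η q) (𝓝[perturbations m ×ˢ Zᶜ] (θ, x))
      (𝓝 0) := by
    have := (hcont.tendsto (θ, x)).mono_left (nhdsWithin_le_nhds (s := perturbations m ×ˢ Zᶜ))
    simpa [hη] using this
  refine squeeze_zero' (Eventually.of_forall fun _ => dist_nonneg) ?_ hlim
  have hev : ∀ᶠ q : (Colour m → ℝ) × Euc m in 𝓝 (θ, x), dist q.2 x ≤ infDist x Z / 2 :=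
    (continuous_snd.tendsto (θ, x)).eventually (p := fun y => dist y x ≤ infDist x Z / 2)
      (closedBall_mem_nhds x (half_pos (infDist_pos_of_notMem hZ hne hx)))
  filter_upwards [self_mem_nhdsWithin, nhdsWithin_le_nhds hev] with q hq hqx
  refine abs_topMass_sub_le (hfin θ hθ _ _) (hfin q.1 hq.1 _ _) (fun v => ?_) ?_
  · refine (abs_sub_le _ (cellWeight θ (Real.log (infDist q.2 Z)) q.2 v) _).trans (add_le_add ?_ ?_)
    · refine abs_cellWeight_sub_le_of_perturbation.trans ?_
      rw [← Real.dist_eq]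
      exact dist_le_pi_dist _ _ _
    · exact abs_cellWeight_infDist_sub_le hZ hne (fun i => hθ i (mem_univ i)) hx hqx v
  · have := infDist_nonneg (x := x) (s := Z)
    positivity

theorem exists_perturbation (m n : ℕ) {p : ℝ} (hp : 0 ≤ p) (hpn : p < n + 1) :
    ∃ B : ℝ≥0∞, B ≠ ⊤ ∧ ∀ Z Ω : Set (Euc m), IsClosed Z → Z.Nonempty → MeasurableSet Ω →
      volume Ω ≠ ⊤ → ∃ θ : Colour m → ℝ, (∀ i, θ i ∈ Icc (0 : ℝ) 1) ∧
        ∫⁻ x in Ω, (ENNReal.ofReal (gap n Z θ x))⁻¹ ^ p ≤ B * volume Ω := by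
  obtain ⟨B, hB, hBle⟩ := exists_lintegral_inv_topMass_le m n hp hpn
  refine ⟨1 + B, by finiteness, fun Z Ω hZ hne hΩ hΩt => ?_⟩
  set U := Ω \ Z with hU
  have hUm : MeasurableSet U := hΩ.diff hZ.measurableSet
  have hUt : volume U ≠ ⊤ := ne_top_of_le_ne_top hΩt (measure_mono sdiff_subset)
  set Φ : (Colour m → ℝ) × Euc m → ℝ≥0∞ := fun q =>
    (ENNReal.ofReal (topMass (n + 1) (cellWeight q.1 (Real.log (infDist q.2 Z)) q.2)))⁻¹ ^ p with hΦ
  have hΦm : AEMeasurable Φ ((perturbationMeasure m).prod (volume.restrict U)) := by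
    rw [perturbationMeasure_eq, Measure.prod_restrict]
    have h1 := (continuousOn_topMass (n := n) hZ hne).mono
      (prod_mono_right (s := perturbations m) (fun x (hx : x ∈ U) => hx.2))
    have h2 := h1.aemeasurable (μ := (volume : Measure (Colour m → ℝ)).prod volume)
      (measurableSet_perturbations.prod hUm)
    fun_prop
  have hswap : ∫⁻ θ, (∫⁻ x in U, Φ (θ, x)) ∂(perturbationMeasure m) ≤ B * volume U := by
    rw [lintegral_lintegral_swap hΦm]
    have h2 : ∀ x, ∫⁻ θ, Φ (θ, x) ∂(perturbationMeasure m) ≤ B := fun x =>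
      hBle (Real.log (infDist x Z)) x
    refine (lintegral_mono h2).trans_eq ?_
    rw [lintegral_const, Measure.restrict_apply_univ]
  obtain ⟨θ, hθ, hle⟩ := exists_notMem_null_le_lintegral
    (f := fun θ => ∫⁻ x in U, Φ (θ, x)) hΦm.lintegral_prod_right' perturbationMeasure_compl
  rw [notMem_compl_iff] at hθ
  refine ⟨θ, fun i => hθ i (mem_univ i), ?_⟩
  rw [← lintegral_inter_add_sdiff _ Ω hZ.measurableSet, add_mul, one_mul]
  refine add_le_add ?_ ?_
  · calc _ = ∫⁻ _x in Ω ∩ Z, 1 := setLIntegral_congr_fun (hΩ.inter hZ.measurableSet) fun x hx => by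
          simp [gap_of_mem hx.2]
      _ = volume (Ω ∩ Z) := by simp
      _ ≤ volume Ω := measure_mono inter_subset_left
  · calc _ = ∫⁻ x in U, Φ (θ, x) := setLIntegral_congr_fun hUm fun x hx => by
          simp [hΦ, gap_of_notMem hx.2]
      _ ≤ B * volume U := hle.trans hswap
      _ ≤ B * volume Ω := by gcongr; exact sdiff_subset

end ChoiceOfPerturbation

section Assembly

open scoped ENNReal

lemma volume_rpow_le_diam {m : ℕ} {p : ℝ} (hp : 1 ≤ p) {Ω : Set (Euc m)}
    (hΩ : Bornology.IsBounded Ω) (hne : Ω.Nonempty) :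
    volume Ω ^ (1 / p) ≤ volume (ball (0 : Euc m) 1) ^ (1 / p) *
      ENNReal.ofReal (diam Ω ^ ((m : ℝ) / p)) := by
  obtain ⟨x, hx⟩ := hne
  have hsub : Ω ⊆ closedBall x (diam Ω) := fun y hy => dist_le_diam_of_mem hΩ hy hx
  have h1 := (measure_mono (μ := volume) hsub).trans_eq
    (Measure.addHaar_closedBall volume x diam_nonneg)
  rw [finrank_euclideanSpace, Fintype.card_fin, mul_comm] at h1
  refine (ENNReal.rpow_le_rpow h1 (by positivity)).trans_eq ?_
  rw [ENNReal.mul_rpow_of_nonneg _ _ (by positivity),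
    ENNReal.ofReal_rpow_of_nonneg (by have := diam_nonneg (s := Ω); positivity) (by positivity),
    ← Real.rpow_natCast_mul diam_nonneg, mul_one_div]

lemma exists_nonempty_compact_superset {m : ℕ} {Z Ω : Set (Euc m)} (hZ : IsCompact Z)
    (hΩ : Ω.Nonempty) (hZΩ : Z ⊆ Ω) {Y : Type} [MetricSpace Y] {L : ℝ} {f : Euc m → Y}
    (hf : ∀ x ∈ Z, ∀ y ∈ Z, dist (f x) (f y) ≤ L * dist x y) :
    ∃ Z' : Set (Euc m), Z ⊆ Z' ∧ IsCompact Z' ∧ Z'.Nonempty ∧ Z' ⊆ Ω ∧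
      ∀ x ∈ Z', ∀ y ∈ Z', dist (f x) (f y) ≤ L * dist x y := by
  rcases Z.eq_empty_or_nonempty with rfl | hne
  · obtain ⟨x₀, hx₀⟩ := hΩ
    refine ⟨{x₀}, empty_subset _, isCompact_singleton, singleton_nonempty _,
      singleton_subset_iff.2 hx₀, ?_⟩
    rintro x rfl y rfl
    simp
  · exact ⟨Z, Subset.rfl, hZ, hne, hZΩ, hf⟩

end Assembly

end Proofs

/-- **Theorem (Sobolev extension into Lipschitz `(n−1)`-connected spaces).**
For `m, n ≥ 1`, `1 ≤ p < n+1`, `c ≥ 1`, there is `C > 0` depending only on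
`m, n, p, c` such that: for every compact `Z ⊂ ℝ^m`, bounded domain `Ω ⊇ Z`, metric
space `Y` Lipschitz `(n−1)`-connected with constant `c`, and `L`-Lipschitz `f : Z → Y`,
there exist `F : Ω → Y` extending `f` and a non-negative `g ∈ L^p(Ω)` with
`‖g‖_{L^p(Ω)} ≤ C L (diam Ω)^{m/p}` witnessing `F ∈ AR^{1,p}(Ω,Y)`; moreover for
every `K`-Lipschitz `φ : Y → ℝ`, `φ ∘ F ∈ W^{1,p}(Ω)` with weak partials dominated by
`K g`, `φ ∘ F` is `ACL`: along the line through a.e. point parallel to any coordinate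
axis it is absolutely continuous on compact subintervals contained in `Ω`, and its
classical partial derivatives (which coincide a.e. with the weak ones) lie in
`L^p(Ω)`. -/
theorem AR_sobolev_extension_into_lipschitz_connected
    (m n : ℕ) (hm : 1 ≤ m) (hn : 1 ≤ n) (p : ℝ) (hp1 : 1 ≤ p) (hp2 : p < n + 1)
    (c : ℝ) (hc : 1 ≤ c) :
    ∃ C : ℝ, 0 < C ∧
      ∀ Z Ω : Set (Euc m), IsCompact Z → IsOpen Ω → IsConnected Ω →
        Bornology.IsBounded Ω → Z ⊆ Ω →
        ∀ (Y : Type) [MetricSpace Y], LipschitzConnected n c Y →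
          ∀ L : ℝ, 0 ≤ L → ∀ f : Euc m → Y,
            (∀ x ∈ Z, ∀ y ∈ Z, dist (f x) (f y) ≤ L * dist x y) →
            ∃ (F : Euc m → Y) (g : Euc m → ℝ),
              (∀ x ∈ Z, F x = f x) ∧
              (∀ x, 0 ≤ g x) ∧
              MemLpOn m p Ω g ∧
              eLpNorm g (ENNReal.ofReal p) (volume.restrict Ω) ≤
                ENNReal.ofReal (C * L * (Metric.diam Ω) ^ ((m : ℝ) / p)) ∧
              ∀ K : ℝ, 0 ≤ K → ∀ φ : Y → ℝ,
                (∀ a b, |φ a - φ b| ≤ K * dist a b) →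
                ∃ w : Fin m → Euc m → ℝ,
                  MemW1pWith m p Ω (fun x => φ (F x)) w ∧
                  (∀ k, ∀ᵐ x ∂(volume.restrict Ω), |w k x| ≤ K * g x) ∧
                  (∀ k : Fin m, ∀ᵐ y : Euc m,
                    ∀ a b : ℝ, a ≤ b →
                      (∀ t ∈ Set.Icc a b, y + t • EuclideanSpace.single k (1:ℝ) ∈ Ω) →
                      ACOn (fun t => φ (F (y + t • EuclideanSpace.single k (1:ℝ)))) a b) ∧
                  (∀ k : Fin m, ∀ᵐ x ∂(volume.restrict Ω),
                    HasDerivAt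
                      (fun t : ℝ => φ (F (x + t • EuclideanSpace.single k (1:ℝ))))
                      (w k x) 0) := by
  obtain ⟨A, hA, hfill⟩ := exists_gapControlled n hc m
  have hp0 : 0 ≤ p := zero_le_one.trans hp1
  obtain ⟨B, hB, hpert⟩ := exists_perturbation m n hp0 hp2
  set κ : ENNReal := (1 + B ^ (1 / p)) * volume (ball (0 : Euc m) 1) ^ (1 / p) with hκ
  have hκt : κ ≠ ⊤ := by
    have h1 : B ^ (1 / p) ≠ ⊤ := ENNReal.rpow_ne_top_of_nonneg (by positivity) hB
    have h2 : volume (ball (0 : Euc m) 1) ^ (1 / p) ≠ ⊤ :=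
      ENNReal.rpow_ne_top_of_nonneg (by positivity) measure_ball_lt_top.ne
    finiteness
  refine ⟨A * κ.toReal + 1, by positivity, ?_⟩
  intro Z Ω hZ hΩo hΩc hΩb hZΩ Y _ hY L hL f hf
  obtain ⟨Z', hZZ', hZ', hne, hZΩ', hf'⟩ :=
    exists_nonempty_compact_superset hZ hΩc.nonempty hZΩ hf
  have hvol : volume Ω ≠ ⊤ := hΩb.measure_lt_top.ne
  obtain ⟨θ, hθ, hinteg⟩ := hpert Z' Ω hZ'.isClosed hne hΩo.measurableSet hvol
  obtain ⟨F, hgap, hFf, hcore⟩ := hfill Z' hZ' hne Y hY L hL f hf' θ hθ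
  have hfin : ∫⁻ x in Ω, (ENNReal.ofReal (gap n Z' θ x))⁻¹ ^ p ≠ ⊤ :=
    ne_top_of_le_ne_top (ENNReal.mul_ne_top hB hvol) hinteg
  refine ⟨F, gapGradient (gap n Z' θ) (A * L), fun x hx => hFf x (hZZ' hx),
    fun x => hgap.gapGradient_nonneg x, hgap.memLp_gapGradient hp1 hvol hfin, ?_,
    fun K hK φ hφ => hgap.exists_weak_derivatives hp1 hΩo hΩb hne hZΩ' hcore hfin hK hφ⟩
  have hd : 0 ≤ diam Ω ^ ((m : ℝ) / p) := Real.rpow_nonneg diam_nonneg _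
  calc _ ≤ _ := hgap.eLpNorm_gapGradient_le hp1
    _ ≤ ENNReal.ofReal (A * L) * (volume Ω ^ (1 / p) + (B * volume Ω) ^ (1 / p)) := by gcongr
    _ = ENNReal.ofReal (A * L) * ((1 + B ^ (1 / p)) * volume Ω ^ (1 / p)) := by
      rw [ENNReal.mul_rpow_of_nonneg _ _ (by positivity), add_mul, one_mul]
    _ ≤ ENNReal.ofReal (A * L) * ((1 + B ^ (1 / p)) * (volume (ball (0 : Euc m) 1) ^ (1 / p) *
        ENNReal.ofReal (diam Ω ^ ((m : ℝ) / p)))) := by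
      gcongr
      exact volume_rpow_le_diam hp1 hΩb hΩc.nonempty
    _ = ENNReal.ofReal (A * L) * (ENNReal.ofReal κ.toReal *
        ENNReal.ofReal (diam Ω ^ ((m : ℝ) / p))) := by
      rw [ENNReal.ofReal_toReal hκt, hκ, mul_assoc]
    _ = ENNReal.ofReal (A * L * (κ.toReal * diam Ω ^ ((m : ℝ) / p))) := by
      rw [ENNReal.ofReal_mul (mul_nonneg hA hL), ENNReal.ofReal_mul ENNReal.toReal_nonneg]
    _ ≤ ENNReal.ofReal ((A * κ.toReal + 1) * L * diam Ω ^ ((m : ℝ) / p)) := by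
      refine ENNReal.ofReal_le_ofReal ?_
      have : 0 ≤ L * diam Ω ^ ((m : ℝ) / p) := by positivity
      linarith

end
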